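/- arXiv:2210.12376 — 2 statements merged into one kernel-verified Lean document; each statement's English description precedes it below -/
import Mathlib

section
/- Let ℓ ≥ 3 be an integer and let G ∈ 𝒢_ℓ have an odd K4-subdivision H. Then no vertex in V(G) − V(H) has two neighbours in V(H). -/
open SimpleGraph

variable {V : Type*}

/-- The list of internal vertices of a walk (its support minus the two ends). -/
def interiorL {G : SimpleGraph V} {a b : V} (p : G.Walk a b) : List V :=
  p.support.tail.dropLast

/-- `p` is an induced path of `G`: a path such that the only edges of `G` between
vertices of `p` are the edges of `p`. -/
def IsInducedPath (G : SimpleGraph V) {a b : V} (p : G.Walk a b) : Prop :=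
  p.IsPath ∧ ∀ x ∈ p.support, ∀ y ∈ p.support, G.Adj x y → s(x, y) ∈ p.edges

/-- A hole of `G`: an induced (chordless) cycle of length at least 4. -/
def IsHole (G : SimpleGraph V) {v : V} (c : G.Walk v v) : Prop :=
  c.IsCycle ∧ 4 ≤ c.length ∧
    ∀ x ∈ c.support, ∀ y ∈ c.support, G.Adj x y → s(x, y) ∈ c.edges

/-- An odd hole of `G`: a hole of odd length. -/
def IsOddHole (G : SimpleGraph V) {v : V} (c : G.Walk v v) : Prop :=
  IsHole G c ∧ Odd c.length

/-- `G ∈ 𝒢ℓ`: `G` has girth `2ℓ+1` and every odd hole of `G` has length exactly `2ℓ+1`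
(equivalently, no odd hole of length at least `2ℓ+3`). -/
def InGFamily (ℓ : ℕ) (G : SimpleGraph V) : Prop :=
  G.egirth = (2 * ℓ + 1 : ℕ) ∧
    ∀ (v : V) (c : G.Walk v v), IsOddHole G c → c.length = 2 * ℓ + 1

/-- `G` is `k`-vertex-critical: `χ(G) = k` and `χ(G − v) < k` for every vertex `v`. -/
def VertexCritical (k : ℕ) (G : SimpleGraph V) : Prop :=
  G.chromaticNumber = (k : ℕ∞) ∧
    ∀ v : V, (G.induce ({v}ᶜ : Set V)).chromaticNumber < (k : ℕ∞)

/-- An odd `K₄`-subdivision in `G`: four distinct branch vertices `u1, u2, u3, u4`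
joined by six internally disjoint paths (the arrises), such that the four face cycles
are all odd holes of `G`. -/
structure OddK4 (G : SimpleGraph V) where
  u1 : V
  u2 : V
  u3 : V
  u4 : V
  /-- the arris joining `u1` and `u2` -/
  P1 : G.Walk u1 u2
  /-- the arris joining `u3` and `u4` -/
  P2 : G.Walk u3 u4
  /-- the arris joining `u2` and `u3` -/
  Q1 : G.Walk u2 u3
  /-- the arris joining `u1` and `u4` -/
  Q2 : G.Walk u1 u4
  /-- the arris joining `u1` and `u3` -/
  L1 : G.Walk u1 u3
  /-- the arris joining `u2` and `u4` -/
  L2 : G.Walk u2 u4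
  hP1 : P1.IsPath
  hP2 : P2.IsPath
  hQ1 : Q1.IsPath
  hQ2 : Q2.IsPath
  hL1 : L1.IsPath
  hL2 : L2.IsPath
  /-- the four branch vertices are pairwise distinct -/
  hnodup : List.Nodup [u1, u2, u3, u4]
  /-- the interiors of the six arrises are pairwise disjoint -/
  hdisj : List.Pairwise List.Disjoint
    [interiorL P1, interiorL P2, interiorL Q1, interiorL Q2, interiorL L1, interiorL L2]
  /-- no branch vertex lies in the interior of an arris -/
  hbranch : ∀ x ∈ interiorL P1 ++ interiorL P2 ++ interiorL Q1 ++ interiorL Q2 ++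
      interiorL L1 ++ interiorL L2, x ∉ [u1, u2, u3, u4]
  /-- the face `u1u2u3` is an odd hole of `G` -/
  face1 : IsOddHole G (P1.append (Q1.append L1.reverse))
  /-- the face `u1u2u4` is an odd hole of `G` -/
  face2 : IsOddHole G (P1.append (L2.append Q2.reverse))
  /-- the face `u1u3u4` is an odd hole of `G` -/
  face3 : IsOddHole G (L1.append (P2.append Q2.reverse))
  /-- the face `u2u3u4` is an odd hole of `G` -/
  face4 : IsOddHole G (Q1.append (P2.append L2.reverse))

/-- The subgraph of `G` formed by an odd `K₄`-subdivision. -/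
def OddK4.toSubgraph {G : SimpleGraph V} (K : OddK4 G) : G.Subgraph :=
  K.P1.toSubgraph ⊔ K.P2.toSubgraph ⊔ K.Q1.toSubgraph ⊔ K.Q2.toSubgraph ⊔
    K.L1.toSubgraph ⊔ K.L2.toSubgraph

/-- The vertex set of an odd `K₄`-subdivision. -/
def OddK4.verts {G : SimpleGraph V} (K : OddK4 G) : Set V :=
  K.toSubgraph.verts

/-- An edge together with a walk joining its ends that avoids it gives a cycle, so the girth
bounds the length of the walk from below. -/
theorem InGFamily.le_length_add_one {ℓ : ℕ} {G : SimpleGraph V} (hG : InGFamily ℓ G) {x y : V}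
    (h : G.Adj x y) (r : G.Walk y x) (hr : s(x, y) ∉ r.edges) : 2 * ℓ + 1 ≤ r.length + 1 := by
  classical
  have hc : (Walk.cons h r.bypass).IsCycle :=
    (Walk.cons_isCycle_iff _ _).2
      ⟨r.bypass_isPath, fun hmem => hr (r.edges_bypass_subset_edges hmem)⟩
  have hle := hG.1 ▸ egirth_le_length hc
  have hlen := r.length_bypass_le_length
  simp only [Walk.length_cons, Nat.cast_le] at hle
  omega

theorem InGFamily.le_length_add_two {ℓ : ℕ} {G : SimpleGraph V} (hG : InGFamily ℓ G) {w a b : V}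
    (ha : G.Adj w a) (hb : G.Adj w b) (hab : a ≠ b) (r : G.Walk a b) (hr : w ∉ r.support) :
    2 * ℓ + 1 ≤ r.length + 2 := by
  have h := hG.le_length_add_one ha (r.append (Walk.cons hb.symm Walk.nil)) (by
    simp only [Walk.edges_append, Walk.edges_cons, Walk.edges_nil, List.mem_append,
      List.mem_singleton, not_or]
    refine ⟨fun hmem => hr (r.fst_mem_support_of_mem_edges hmem), fun he => ?_⟩
    rcases Sym2.eq_iff.1 he with ⟨h1, -⟩ | ⟨-, h2⟩
    · exact hb.ne h1
    · exact hab h2)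
  simpa using h

/-- A vertex outside a closed walk of length `2ℓ+1` has at most one neighbour on it. -/
theorem InGFamily.eq_of_adj_of_mem_support {ℓ : ℕ} (hℓ : 2 ≤ ℓ) {G : SimpleGraph V}
    (hG : InGFamily ℓ G) {v w a b : V} (c : G.Walk v v) (hc : c.length = 2 * ℓ + 1)
    (hw : w ∉ c.support) (ha : a ∈ c.support) (hb : b ∈ c.support)
    (hwa : G.Adj w a) (hwb : G.Adj w b) : a = b := by
  classical
  by_contra hab
  have hb' : b ∈ (c.rotate a ha).support := (c.mem_support_rotate_iff a ha).2 hb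
  have hw' : w ∉ (c.rotate a ha).support := fun h => hw ((c.mem_support_rotate_iff a ha).1 h)
  have h1 := hG.le_length_add_two hwa hwb hab ((c.rotate a ha).takeUntil b hb')
    (fun h => hw' ((c.rotate a ha).support_takeUntil_subset_support hb' h))
  have h2 := hG.le_length_add_two hwb hwa (Ne.symm hab) ((c.rotate a ha).dropUntil b hb')
    (fun h => hw' ((c.rotate a ha).support_dropUntil_subset_support hb' h))
  have h3 := congrArg Walk.length ((c.rotate a ha).take_spec hb')
  rw [Walk.length_append, Walk.length_rotate] at h3
  omega

/-- The girth bound for a closed walk made of four pieces, the first of which is a path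
whose initial edge is not repeated. -/
theorem InGFamily.le_length_four {ℓ : ℕ} {G : SimpleGraph V} (hG : InGFamily ℓ G) {u v x y : V}
    (huv : u ≠ v) (A : G.Walk u v) (B : G.Walk v x) (C : G.Walk x y) (D : G.Walk y u)
    (hA : A.IsPath) (hAB : A.edges.Disjoint B.edges) (hAD : A.edges.Disjoint D.edges)
    (hC : u ∉ C.support) : 2 * ℓ + 1 ≤ A.length + B.length + C.length + D.length := by
  cases A with
  | nil => exact absurd rfl huv
  | cons h A =>
    have he := (Walk.edges_cons h A) ▸ List.mem_cons_self
    have := hG.le_length_add_one h (A.append (B.append (C.append D))) (by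
      simp only [Walk.edges_append, List.mem_append, not_or]
      exact ⟨fun hm => ((Walk.cons_isPath_iff h A).1 hA).2 (A.fst_mem_support_of_mem_edges hm),
        hAB he, fun hm => hC (C.fst_mem_support_of_mem_edges hm), hAD he⟩)
    simp only [Walk.length_append, Walk.length_cons] at this ⊢
    omega

/-- A vertex outside a `K₄`-subdivision with suitable arris lengths has no two distinct
neighbours on opposite arrises. -/
theorem InGFamily.eq_of_adj_opposite {ℓ : ℕ} (hℓ : 3 ≤ ℓ) {G : SimpleGraph V}
    (hG : InGFamily ℓ G) {u1 u2 u3 u4 w a b : V}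
    (P1 : G.Walk u1 u2) (P2 : G.Walk u3 u4) (Q1 : G.Walk u2 u3) (Q2 : G.Walk u1 u4)
    (L1 : G.Walk u1 u3) (L2 : G.Walk u2 u4)
    (hP : P1.length = P2.length) (hQ : Q1.length = Q2.length) (hL : L1.length = L2.length)
    (hsum : P1.length + Q1.length + L1.length = 2 * ℓ + 1)
    (hQL : 2 * ℓ + 1 ≤ 2 * (Q1.length + L1.length))
    (hwP1 : w ∉ P1.support) (hwP2 : w ∉ P2.support) (hwQ1 : w ∉ Q1.support)
    (hwQ2 : w ∉ Q2.support) (hwL1 : w ∉ L1.support) (hwL2 : w ∉ L2.support)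
    (ha : a ∈ P1.support) (hb : b ∈ P2.support)
    (hwa : G.Adj w a) (hwb : G.Adj w b) : a = b := by
  classical
  by_contra hab
  have hat : w ∉ (P1.takeUntil a ha).support :=
    fun h => hwP1 (P1.support_takeUntil_subset_support ha h)
  have had : w ∉ (P1.dropUntil a ha).support :=
    fun h => hwP1 (P1.support_dropUntil_subset_support ha h)
  have hbt : w ∉ (P2.takeUntil b hb).support :=
    fun h => hwP2 (P2.support_takeUntil_subset_support hb h)
  have hbd : w ∉ (P2.dropUntil b hb).support :=
    fun h => hwP2 (P2.support_dropUntil_subset_support hb h)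
  have h1 := hG.le_length_add_two hwa hwb hab
    ((P1.takeUntil a ha).reverse.append (L1.append (P2.takeUntil b hb))) (by
      simp [Walk.mem_support_append_iff, hat, hbt, hwL1])
  have h2 := hG.le_length_add_two hwa hwb hab
    ((P1.takeUntil a ha).reverse.append (Q2.append (P2.dropUntil b hb).reverse)) (by
      simp [Walk.mem_support_append_iff, hat, hbd, hwQ2])
  have h3 := hG.le_length_add_two hwa hwb hab
    ((P1.dropUntil a ha).append (Q1.append (P2.takeUntil b hb))) (by
      simp [Walk.mem_support_append_iff, had, hbt, hwQ1])
  have h4 := hG.le_length_add_two hwa hwb hab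
    ((P1.dropUntil a ha).append (L2.append (P2.dropUntil b hb).reverse)) (by
      simp [Walk.mem_support_append_iff, had, hbd, hwL2])
  have h5 := congrArg Walk.length (P1.take_spec ha)
  have h6 := congrArg Walk.length (P2.take_spec hb)
  simp only [Walk.length_append, Walk.length_reverse] at h1 h2 h3 h4 h5 h6
  omega

theorem mem_interiorL_of_mem_support {G : SimpleGraph V} {a b x : V} (p : G.Walk a b)
    (hx : x ∈ p.support) (ha : x ≠ a) (hb : x ≠ b) : x ∈ interiorL p := by
  have hx' : x ∈ p.support.tail := (p.mem_support_iff.1 hx).resolve_left ha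
  have hne : p.support.tail ≠ [] := List.ne_nil_of_mem hx'
  have hlast : p.support.tail.getLast hne = b := by
    rw [List.getLast_tail, Walk.getLast_support]
  rw [← List.dropLast_append_getLast hne, hlast] at hx'
  simpa [interiorL, hb] using hx'

/-- The three arrises of a face have total length `2ℓ+1`. -/
theorem InGFamily.length_face {ℓ : ℕ} {G : SimpleGraph V} (hG : InGFamily ℓ G) {u v x : V}
    {A : G.Walk u v} {B : G.Walk v x} {C : G.Walk u x}
    (h : IsOddHole G (A.append (B.append C.reverse))) :
    A.length + B.length + C.length = 2 * ℓ + 1 := by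
  have := hG.2 _ _ h
  simpa [add_assoc] using this

theorem IsOddHole.edges_disjoint {G : SimpleGraph V} {u v x : V}
    {A : G.Walk u v} {B : G.Walk v x} {C : G.Walk u x}
    (h : IsOddHole G (A.append (B.append C.reverse))) :
    A.edges.Disjoint B.edges ∧ A.edges.Disjoint C.edges ∧ B.edges.Disjoint C.edges := by
  have hn := h.1.1.isTrail.edges_nodup
  simp only [Walk.edges_append, Walk.edges_reverse, List.nodup_append', List.disjoint_append_right,
    List.disjoint_reverse_right] at hn
  tauto

/-- Lemma 2.6 (3): for `ℓ ≥ 3`, no vertex of `G ∈ 𝒢ℓ` outside an odd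
`K₄`-subdivision `H` has two neighbours in `V(H)`. -/
theorem oddK4_no_two_neighbours {V : Type*} (ℓ : ℕ) (hℓ : 3 ≤ ℓ) (G : SimpleGraph V)
    (hG : InGFamily ℓ G) (K : OddK4 G) :
    ∀ w : V, w ∉ K.verts → ∀ a ∈ K.verts, ∀ b ∈ K.verts,
      G.Adj w a → G.Adj w b → a = b := by
  intro w hw a ha b hb hwa hwb
  have mem : ∀ x, x ∈ K.verts ↔ x ∈ K.P1.support ∨ x ∈ K.P2.support ∨ x ∈ K.Q1.support ∨
      x ∈ K.Q2.support ∨ x ∈ K.L1.support ∨ x ∈ K.L2.support := by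
    intro x
    simp [OddK4.verts, OddK4.toSubgraph, or_assoc]
  rw [mem] at hw ha hb
  simp only [not_or] at hw
  obtain ⟨wP1, wP2, wQ1, wQ2, wL1, wL2⟩ := hw
  have l1 := hG.length_face K.face1
  have l2 := hG.length_face K.face2
  have l3 := hG.length_face K.face3
  have l4 := hG.length_face K.face4
  obtain ⟨-, d1, -⟩ := K.face1.edges_disjoint
  obtain ⟨d2, d3, d4⟩ := K.face2.edges_disjoint
  obtain ⟨-, d5, -⟩ := K.face3.edges_disjoint
  obtain ⟨d6, -, -⟩ := K.face1.edges_disjoint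
  have hn := K.hnodup
  simp only [List.nodup_cons, List.mem_cons, List.not_mem_nil, or_false, not_or] at hn
  obtain ⟨⟨n12, n13, n14⟩, -⟩ := hn
  have hP2 : K.u1 ∉ K.P2.support := fun h =>
    K.hbranch K.u1 (by simp [mem_interiorL_of_mem_support _ h n13 n14]) (by simp)
  have hQ1 : K.u1 ∉ K.Q1.support := fun h =>
    K.hbranch K.u1 (by simp [mem_interiorL_of_mem_support _ h n12 n13]) (by simp)
  have g1 := hG.le_length_four n14 K.Q2 K.L2.reverse K.Q1 K.L1.reverse K.hQ2
    (by simpa using d4.symm) (by simpa using d5.symm) hQ1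
  have g2 := hG.le_length_four n12 K.P1 K.L2 K.P2.reverse K.L1.reverse K.hP1
    d2 (by simpa using d1) (by simpa using hP2)
  have g3 := hG.le_length_four n12 K.P1 K.Q1 K.P2 K.Q2.reverse K.hP1
    d6 (by simpa using d3) hP2
  simp only [Walk.length_reverse] at g1 g2 g3
  have oppP : ∀ {a b}, a ∈ K.P1.support → b ∈ K.P2.support → G.Adj w a → G.Adj w b → a = b :=
    hG.eq_of_adj_opposite hℓ K.P1 K.P2 K.Q1 K.Q2 K.L1 K.L2 (by omega) (by omega) (by omega)
      (by omega) (by omega) wP1 wP2 wQ1 wQ2 wL1 wL2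
  have oppQ : ∀ {a b}, a ∈ K.Q1.support → b ∈ K.Q2.support → G.Adj w a → G.Adj w b → a = b :=
    hG.eq_of_adj_opposite hℓ K.Q1 K.Q2 K.L1.reverse K.L2 K.P1.reverse K.P2
      (by omega) (by simp only [Walk.length_reverse]; omega)
      (by simp only [Walk.length_reverse]; omega) (by simp only [Walk.length_reverse]; omega)
      (by simp only [Walk.length_reverse]; omega) wQ1 wQ2 (by simpa using wL1) wL2
      (by simpa using wP1) wP2
  have oppL : ∀ {a b}, a ∈ K.L1.support → b ∈ K.L2.support → G.Adj w a → G.Adj w b → a = b :=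
    hG.eq_of_adj_opposite hℓ K.L1 K.L2 K.Q1.reverse K.Q2 K.P1 K.P2
      (by omega) (by simp only [Walk.length_reverse]; omega)
      (by omega) (by simp only [Walk.length_reverse]; omega)
      (by simp only [Walk.length_reverse]; omega) wL1 wL2 (by simpa using wQ1) wQ2 wP1 wP2
  have onFace : ∀ {v} (c : G.Walk v v), IsOddHole G c → w ∉ c.support → a ∈ c.support →
      b ∈ c.support → a = b := fun c hc hwc hac hbc =>
    hG.eq_of_adj_of_mem_support (by omega) c (hG.2 _ c hc) hwc hac hbc hwa hwb
  have f1 := onFace _ K.face1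
  have f2 := onFace _ K.face2
  have f3 := onFace _ K.face3
  have f4 := onFace _ K.face4
  simp only [Walk.mem_support_append_iff, Walk.support_reverse, List.mem_reverse, wP1, wP2, wQ1,
    wQ2, wL1, wL2, or_self, not_false_eq_true, true_imp_iff] at f1 f2 f3 f4
  rcases ha with ha | ha | ha | ha | ha | ha <;> rcases hb with hb | hb | hb | hb | hb | hb <;>
    first
    | exact oppP ha hb hwa hwb
    | exact oppQ ha hb hwa hwb
    | exact oppL ha hb hwa hwb
    | exact (oppP hb ha hwb hwa).symm
    | exact (oppQ hb ha hwb hwa).symm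
    | exact (oppL hb ha hwb hwa).symm
    | exact f1 (by simp [ha]) (by simp [hb])
    | exact f2 (by simp [ha]) (by simp [hb])
    | exact f3 (by simp [ha]) (by simp [hb])
    | exact f4 (by simp [ha]) (by simp [hb])
end

section
/- In the setup below, the vertex x does not belong to V(P1). -/
open SimpleGraph

variable {V : Type*}

/-- `P1, P2` form a pair of longest arrises of the odd `K₄`-subdivision `K`. -/
def OddK4.longestPair {G : SimpleGraph V} (K : OddK4 G) : Prop :=
  K.Q1.length ≤ K.P1.length ∧ K.Q2.length ≤ K.P1.length ∧
    K.L1.length ≤ K.P1.length ∧ K.L2.length ≤ K.P1.length ∧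
    K.Q1.length ≤ K.P2.length ∧ K.Q2.length ≤ K.P2.length ∧
    K.L1.length ≤ K.P2.length ∧ K.L2.length ≤ K.P2.length

/-- The difference `d(H) = |P1| − min(|Q1|, |L1|)` of an odd `K₄`-subdivision
(labelled so that `P1, P2` is a pair of longest arrises). -/
def OddK4.diff {G : SimpleGraph V} (K : OddK4 G) : ℕ :=
  K.P1.length - min K.Q1.length K.L1.length

section Walks

variable {G : SimpleGraph V} {a b c : V}

theorem isPath_append_of_inter {p : G.Walk a b} {q : G.Walk b c} (hp : p.IsPath) (hq : q.IsPath)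
    (h : ∀ w ∈ p.support, w ∈ q.support → w = b) : (p.append q).IsPath := by
  rw [Walk.isPath_def, Walk.support_append, List.nodup_append']
  have hq' := hq.support_nodup
  rw [← Walk.cons_tail_support, List.nodup_cons] at hq'
  refine ⟨hp.support_nodup, hq'.2, fun w hw hw' => hq'.1 ?_⟩
  have := h w hw (List.mem_of_mem_tail hw')
  subst this
  exact hw'

theorem inter_of_isPath_append {p : G.Walk a b} {q : G.Walk b c} (h : (p.append q).IsPath)
    {w : V} (hp : w ∈ p.support) (hq : w ∈ q.support) : w = b := by
  by_contra hw
  exact h.ne_of_mem_support_of_append hw hp hq rfl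

theorem isCycle_append_of_inter {p : G.Walk a b} {q : G.Walk b a} (hp : p.IsPath) (hq : q.IsPath)
    (h : ∀ w ∈ p.support, w ∈ q.support → w = a ∨ w = b) (hlen : 3 ≤ p.length + q.length) :
    (p.append q).IsCycle := by
  refine hp.isCycle_append hq (fun w hw hw' => ?_) (by lia)
  have hp' := hp.support_nodup
  have hq' := hq.support_nodup
  rw [← Walk.cons_tail_support, List.nodup_cons] at hp' hq'
  rcases h w (List.mem_of_mem_tail hw) (List.mem_of_mem_tail hw') with rfl | rfl
  · exact hp'.1 hw
  · exact hq'.1 hw'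

theorem isHole_append_of_inter {p : G.Walk a b} {q : G.Walk b a} (hp : p.IsPath) (hq : q.IsPath)
    (h : ∀ w ∈ p.support, w ∈ q.support → w = a ∨ w = b) (hlen : 4 ≤ p.length + q.length)
    (hind : ∀ u v, (u ∈ p.support ∨ u ∈ q.support) → (v ∈ p.support ∨ v ∈ q.support) →
      G.Adj u v → s(u, v) ∈ p.edges ∨ s(u, v) ∈ q.edges) :
    IsHole G (p.append q) := by
  refine ⟨isCycle_append_of_inter hp hq h (by lia), by simpa using hlen, fun u hu v hv huv => ?_⟩
  rw [Walk.mem_support_append_iff] at hu hv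
  rw [Walk.edges_append, List.mem_append]
  exact hind u v hu hv huv

theorem isOddHole_append_comm {p : G.Walk a b} {q : G.Walk b a} (h : IsOddHole G (p.append q)) :
    IsOddHole G (q.append p) := by
  obtain ⟨⟨hc, hl, hi⟩, ho⟩ := h
  rw [Walk.length_append, add_comm, ← Walk.length_append] at hl ho
  refine ⟨⟨?_, hl, fun u hu v hv huv => ?_⟩, ho⟩
  · rw [Walk.isCycle_def, Walk.isTrail_def, Walk.edges_append, Walk.tail_support_append] at hc ⊢
    refine ⟨List.perm_append_comm.nodup_iff.1 hc.1, fun h0 => ?_,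
      List.perm_append_comm.nodup_iff.1 hc.2.2⟩
    have := congrArg Walk.length h0
    rw [Walk.length_append, Walk.length_nil] at this
    rw [Walk.length_append] at hl
    lia
  · rw [Walk.mem_support_append_iff] at hu hv
    have := hi u (by rw [Walk.mem_support_append_iff]; exact hu.symm) v
      (by rw [Walk.mem_support_append_iff]; exact hv.symm) huv
    simp only [Walk.edges_append, List.mem_append] at this ⊢
    exact this.symm

theorem isOddHole_reverse {p : G.Walk a a} (h : IsOddHole G p) : IsOddHole G p.reverse := by
  obtain ⟨⟨hc, hl, hi⟩, ho⟩ := h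
  refine ⟨⟨hc.reverse, by simpa using hl, fun u hu v hv huv => ?_⟩, by simpa using ho⟩
  simp only [Walk.support_reverse, Walk.edges_reverse, List.mem_reverse] at *
  exact hi u hu v hv huv

theorem girth_le_length_add_one {ℓ : ℕ} (hg : G.egirth = (2 * ℓ + 1 : ℕ)) (h : G.Adj a b)
    (w : G.Walk b a) (hw : s(a, b) ∉ w.edges) : 2 * ℓ + 1 ≤ w.length + 1 := by
  classical
  have hc : (Walk.cons h w.bypass).IsCycle :=
    (Walk.cons_isCycle_iff _ _).2 ⟨w.bypass_isPath, fun h' => hw (w.edges_bypass_subset_edges h')⟩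
  have h1 := egirth_le_length hc
  rw [hg] at h1
  have h2 : 2 * ℓ + 1 ≤ (Walk.cons h w.bypass).length := by exact_mod_cast h1
  have h3 := w.length_bypass_le_length
  simp only [Walk.length_cons] at h2
  lia

theorem girth_le_length {ℓ : ℕ} (hg : G.egirth = (2 * ℓ + 1 : ℕ)) {w : G.Walk a a}
    (hw : w.IsCycle) : 2 * ℓ + 1 ≤ w.length := by
  have h1 := egirth_le_length hw
  rw [hg] at h1
  exact_mod_cast h1

theorem mem_interiorL {p : G.Walk a b} (hp : p.IsPath) {w : V} :
    w ∈ interiorL p ↔ w ∈ p.support ∧ w ≠ a ∧ w ≠ b := by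
  cases p with
  | nil => simp [interiorL]
  | cons h q =>
    have h1 := hp.support_nodup
    have h2 := q.dropLast_support_concat
    have h3 : q.support.Nodup := by simp at h1; exact h1.2
    rw [← h2] at h3
    have h4 : w ∈ q.support ↔ w ∈ q.support.dropLast ++ [b] := by rw [h2]
    simp only [List.mem_append, List.mem_singleton] at h4
    simp only [Walk.support_cons, List.nodup_cons] at h1
    simp only [interiorL, Walk.support_cons, List.tail_cons, List.mem_cons, h4]
    simp only [List.nodup_append'] at h3
    grind

theorem mem_support_append_reverse {p : G.Walk a b} {q : G.Walk c b} {w : V} :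
    w ∈ (p.append q.reverse).support ↔ w ∈ p.support ∨ w ∈ q.support := by
  simp [Walk.mem_support_append_iff]

end Walks

namespace OddK4

variable {G : SimpleGraph V} {ℓ : ℕ}

/-- The vertex `w` lies on one of the arrises. -/
def On (K : OddK4 G) (w : V) : Prop :=
  w ∈ K.P1.support ∨ w ∈ K.P2.support ∨ w ∈ K.Q1.support ∨ w ∈ K.Q2.support ∨
    w ∈ K.L1.support ∨ w ∈ K.L2.support

/-- The unordered pair `e` is an edge of one of the arrises. -/
def HasEdge (K : OddK4 G) (e : Sym2 V) : Prop :=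
  e ∈ K.P1.edges ∨ e ∈ K.P2.edges ∨ e ∈ K.Q1.edges ∨ e ∈ K.Q2.edges ∨
    e ∈ K.L1.edges ∨ e ∈ K.L2.edges

theorem mem_verts_iff_on (K : OddK4 G) {w : V} : w ∈ K.verts ↔ K.On w := by
  simp [verts, toSubgraph, On, or_assoc]

theorem ne (K : OddK4 G) : K.u1 ≠ K.u2 ∧ K.u1 ≠ K.u3 ∧ K.u1 ≠ K.u4 ∧ K.u2 ≠ K.u3 ∧
    K.u2 ≠ K.u4 ∧ K.u3 ≠ K.u4 := by
  have := K.hnodup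
  simp at this
  grind

theorem mem_interiorL_iff (K : OddK4 G) :
    (∀ w, w ∈ interiorL K.P1 ↔ w ∈ K.P1.support ∧ w ≠ K.u1 ∧ w ≠ K.u2) ∧
    (∀ w, w ∈ interiorL K.P2 ↔ w ∈ K.P2.support ∧ w ≠ K.u3 ∧ w ≠ K.u4) ∧
    (∀ w, w ∈ interiorL K.Q1 ↔ w ∈ K.Q1.support ∧ w ≠ K.u2 ∧ w ≠ K.u3) ∧
    (∀ w, w ∈ interiorL K.Q2 ↔ w ∈ K.Q2.support ∧ w ≠ K.u1 ∧ w ≠ K.u4) ∧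
    (∀ w, w ∈ interiorL K.L1 ↔ w ∈ K.L1.support ∧ w ≠ K.u1 ∧ w ≠ K.u3) ∧
    (∀ w, w ∈ interiorL K.L2 ↔ w ∈ K.L2.support ∧ w ≠ K.u2 ∧ w ≠ K.u4) :=
  ⟨fun _ => mem_interiorL K.hP1, fun _ => mem_interiorL K.hP2, fun _ => mem_interiorL K.hQ1,
    fun _ => mem_interiorL K.hQ2, fun _ => mem_interiorL K.hL1, fun _ => mem_interiorL K.hL2⟩

/-- Two distinct arrises meet at most in a common end. -/
structure Meets (K : OddK4 G) (w : V) : Prop where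
  P1P2 : w ∈ K.P1.support → w ∉ K.P2.support
  Q1Q2 : w ∈ K.Q1.support → w ∉ K.Q2.support
  L1L2 : w ∈ K.L1.support → w ∉ K.L2.support
  P1Q1 : w ∈ K.P1.support → w ∈ K.Q1.support → w = K.u2
  P1Q2 : w ∈ K.P1.support → w ∈ K.Q2.support → w = K.u1
  P1L1 : w ∈ K.P1.support → w ∈ K.L1.support → w = K.u1
  P1L2 : w ∈ K.P1.support → w ∈ K.L2.support → w = K.u2
  P2Q1 : w ∈ K.P2.support → w ∈ K.Q1.support → w = K.u3
  P2Q2 : w ∈ K.P2.support → w ∈ K.Q2.support → w = K.u4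
  P2L1 : w ∈ K.P2.support → w ∈ K.L1.support → w = K.u3
  P2L2 : w ∈ K.P2.support → w ∈ K.L2.support → w = K.u4
  Q1L1 : w ∈ K.Q1.support → w ∈ K.L1.support → w = K.u3
  Q1L2 : w ∈ K.Q1.support → w ∈ K.L2.support → w = K.u2
  Q2L1 : w ∈ K.Q2.support → w ∈ K.L1.support → w = K.u1
  Q2L2 : w ∈ K.Q2.support → w ∈ K.L2.support → w = K.u4

theorem meets (K : OddK4 G) (w : V) : K.Meets w := by
  obtain ⟨n12, n13, n14, n23, n24, n34⟩ := K.ne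
  obtain ⟨i1, i2, i3, i4, i5, i6⟩ := K.mem_interiorL_iff
  have hb := K.hbranch w
  have hd := K.hdisj
  simp only [List.mem_append, i1, i2, i3, i4, i5, i6, List.mem_cons, List.not_mem_nil, or_false,
    not_or] at hb
  simp only [List.pairwise_cons, List.mem_cons, List.not_mem_nil, or_false, forall_eq_or_imp,
    forall_eq, List.disjoint_left, i1, i2, i3, i4, i5, i6] at hd
  obtain ⟨⟨d1, d2, d3, d4, d5⟩, ⟨d6, d7, d8, d9⟩, ⟨d10, d11, d12⟩, ⟨d13, d14⟩, d15, -⟩ := hd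
  constructor <;> grind

theorem length_faces (K : OddK4 G) (hG : InGFamily ℓ G) :
    K.P1.length = K.P2.length ∧ K.Q1.length = K.Q2.length ∧ K.L1.length = K.L2.length ∧
      K.P1.length + K.Q1.length + K.L1.length = 2 * ℓ + 1 := by
  have h1 := hG.2 _ _ K.face1
  have h2 := hG.2 _ _ K.face2
  have h3 := hG.2 _ _ K.face3
  have h4 := hG.2 _ _ K.face4
  simp only [Walk.length_append, Walk.length_reverse] at h1 h2 h3 h4
  lia

theorem length_pos (K : OddK4 G) : 0 < K.P1.length ∧ 0 < K.P2.length ∧ 0 < K.Q1.length ∧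
    0 < K.Q2.length ∧ 0 < K.L1.length ∧ 0 < K.L2.length := by
  obtain ⟨n12, n13, n14, n23, n24, n34⟩ := K.ne
  simp only [← Walk.not_nil_iff_lt_length]
  refine ⟨?_, ?_, ?_, ?_, ?_, ?_⟩ <;> exact Walk.not_nil_of_ne ‹_›

theorem length_P1_le (K : OddK4 G) (hG : InGFamily ℓ G) : K.P1.length ≤ ℓ := by
  obtain ⟨n12, n13, n14, n23, n24, n34⟩ := K.ne
  obtain ⟨h1, h2, h3, h4⟩ := K.length_faces hG
  obtain ⟨l1, l2, l3, l4, l5, l6⟩ := K.length_pos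
  have hc : ((K.L1.append K.Q1.reverse).append (K.L2.append K.Q2.reverse)).IsCycle := by
    apply isCycle_append_of_inter
    · refine isPath_append_of_inter K.hL1 K.hQ1.reverse fun w hw hw' => ?_
      rw [Walk.support_reverse, List.mem_reverse] at hw'
      exact (K.meets w).Q1L1 hw' hw
    · refine isPath_append_of_inter K.hL2 K.hQ2.reverse fun w hw hw' => ?_
      rw [Walk.support_reverse, List.mem_reverse] at hw'
      exact (K.meets w).Q2L2 hw' hw
    · intro w
      simp only [mem_support_append_reverse]
      have := K.meets w
      rintro (hw | hw) (hw' | hw')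
      · exact absurd hw' (this.L1L2 hw)
      · exact Or.inl (this.Q2L1 hw' hw)
      · exact Or.inr (this.Q1L2 hw hw')
      · exact absurd hw' (this.Q1Q2 hw)
    · simp only [Walk.length_append, Walk.length_reverse]
      lia
  have := girth_le_length hG.1 hc
  simp only [Walk.length_append, Walk.length_reverse] at this
  lia

end OddK4

theorem not_adj_of_walks {G : SimpleGraph V} {ℓ : ℕ} (hℓ : 2 ≤ ℓ)
    (hg : G.egirth = (2 * ℓ + 1 : ℕ)) {u1 u2 u3 u4 : V}
    (P1 : G.Walk u1 u2) (P2 : G.Walk u3 u4) (Q1 : G.Walk u2 u3) (Q2 : G.Walk u1 u4)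
    (L1 : G.Walk u1 u3) (L2 : G.Walk u2 u4) (hP : P1.length = P2.length)
    (hQ : Q1.length = Q2.length) (hL : L1.length = L2.length)
    (hs : P1.length + Q1.length + L1.length = 2 * ℓ + 1) (hle : P1.length ≤ ℓ)
    {a b : V} (ha : a ∈ P1.support) (hb : b ∈ P2.support)
    (hP1 : s(a, b) ∉ P1.edges) (hP2 : s(a, b) ∉ P2.edges) (hQ1 : s(a, b) ∉ Q1.edges)
    (hQ2 : s(a, b) ∉ Q2.edges) (hL1 : s(a, b) ∉ L1.edges) (hL2 : s(a, b) ∉ L2.edges) :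
    ¬ G.Adj a b := by
  intro hab
  obtain ⟨p, p', rfl⟩ := Walk.mem_support_iff_exists_append.1 ha
  obtain ⟨r, r', rfl⟩ := Walk.mem_support_iff_exists_append.1 hb
  simp only [Walk.edges_append, List.mem_append, not_or] at hP1 hP2
  have c1 := girth_le_length_add_one hg hab (r.reverse.append (L1.reverse.append p))
    (by simp [Walk.edges_append, *])
  have c2 := girth_le_length_add_one hg hab (r'.append (Q2.reverse.append p))
    (by simp [Walk.edges_append, *])
  have c3 := girth_le_length_add_one hg hab (r.reverse.append (Q1.reverse.append p'.reverse))
    (by simp [Walk.edges_append, *])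
  have c4 := girth_le_length_add_one hg hab (r'.append (L2.reverse.append p'.reverse))
    (by simp [Walk.edges_append, *])
  simp only [Walk.length_append, Walk.length_reverse] at *
  lia

namespace OddK4

variable {G : SimpleGraph V} {ℓ : ℕ}

theorem hasEdge_of_adj (K : OddK4 G) (hG : InGFamily ℓ G) (hℓ : 2 ≤ ℓ) (hlong : K.longestPair)
    {a b : V} (ha : K.On a) (hb : K.On b) (hab : G.Adj a b) : K.HasEdge s(a, b) := by
  obtain ⟨h1, h2, h3, h4⟩ := K.length_faces hG
  have hp := K.length_P1_le hG
  unfold longestPair at hlong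
  have hP : ∀ a b, a ∈ K.P1.support → b ∈ K.P2.support → G.Adj a b → K.HasEdge s(a, b) := by
    intro a b ha hb hab
    by_contra he
    simp only [HasEdge, not_or] at he
    exact not_adj_of_walks hℓ hG.1 K.P1 K.P2 K.Q1 K.Q2 K.L1 K.L2 h1 h2 h3 h4 hp ha hb
      (by simp [he]) (by simp [he]) (by simp [he]) (by simp [he]) (by simp [he]) (by simp [he]) hab
  have hQ : ∀ a b, a ∈ K.Q1.support → b ∈ K.Q2.support → G.Adj a b → K.HasEdge s(a, b) := by
    intro a b ha hb hab
    by_contra he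
    simp only [HasEdge, not_or] at he
    exact not_adj_of_walks hℓ hG.1 K.Q1 K.Q2 K.L1.reverse K.L2 K.P1.reverse K.P2 h2
      (by simpa using h3) (by simpa using h1) (by simp; lia) (by lia) ha hb
      (by simp [he]) (by simp [he]) (by simp [he]) (by simp [he]) (by simp [he]) (by simp [he]) hab
  have hL : ∀ a b, a ∈ K.L1.support → b ∈ K.L2.support → G.Adj a b → K.HasEdge s(a, b) := by
    intro a b ha hb hab
    by_contra he
    simp only [HasEdge, not_or] at he
    exact not_adj_of_walks hℓ hG.1 K.L1 K.L2 K.Q1.reverse K.Q2 K.P1 K.P2 h3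
      (by simpa using h2) (by simpa using h1) (by simp; lia) (by lia) ha hb
      (by simp [he]) (by simp [he]) (by simp [he]) (by simp [he]) (by simp [he]) (by simp [he]) hab
  have f1 := K.face1.1.2.2 a
  have f2 := K.face2.1.2.2 a
  have f3 := K.face3.1.2.2 a
  have f4 := K.face4.1.2.2 a
  simp only [Walk.mem_support_append_iff, Walk.edges_append, Walk.support_reverse,
    Walk.edges_reverse, List.mem_append, List.mem_reverse] at f1 f2 f3 f4
  have hP' := hP a b
  have hP'' := hP b a
  have hQ' := hQ a b
  have hQ'' := hQ b a
  have hL' := hL a b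
  have hL'' := hL b a
  rw [Sym2.eq_swap (a := b)] at hP'' hQ'' hL''
  have hba := hab.symm
  replace f1 := fun h h' => f1 h b h' hab
  replace f2 := fun h h' => f2 h b h' hab
  replace f3 := fun h h' => f3 h b h' hab
  replace f4 := fun h h' => f4 h b h' hab
  unfold HasEdge On at *
  clear hP hQ hL
  rcases ha with ha | ha | ha | ha | ha | ha <;> rcases hb with hb | hb | hb | hb | hb | hb <;>
    grind

/-- The same odd `K₄`-subdivision, with the names of `u3` and `u4` exchanged. -/
def swap34 (K : OddK4 G) : OddK4 G where
  u1 := K.u1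
  u2 := K.u2
  u3 := K.u4
  u4 := K.u3
  P1 := K.P1
  P2 := K.P2.reverse
  Q1 := K.L2
  Q2 := K.L1
  L1 := K.Q2
  L2 := K.Q1
  hP1 := K.hP1
  hP2 := K.hP2.reverse
  hQ1 := K.hL2
  hQ2 := K.hL1
  hL1 := K.hQ2
  hL2 := K.hQ1
  hnodup := by
    obtain ⟨n12, n13, n14, n23, n24, n34⟩ := K.ne
    simp [*, n34.symm]
  hdisj := by
    simp only [List.pairwise_cons, List.mem_cons, List.not_mem_nil, or_false, forall_eq_or_imp,
      forall_eq, List.disjoint_left, mem_interiorL, K.hP1, K.hQ1, K.hQ2, K.hL1, K.hL2,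
      K.hP2.reverse, Walk.support_reverse, List.mem_reverse]
    refine ⟨⟨?_, ?_, ?_, ?_, ?_⟩, ⟨?_, ?_, ?_, ?_⟩, ⟨?_, ?_, ?_⟩, ⟨?_, ?_⟩, ?_, by simp⟩ <;>
    · rintro w ⟨hw, h1, h2⟩ ⟨hw', h3, h4⟩
      obtain ⟨_, _, _, _, _, _, _, _, _, _, _, _, _, _, _⟩ := K.meets w
      simp_all
  hbranch := by
    intro w
    have hb := K.hbranch w
    simp only [List.mem_append, mem_interiorL, K.hP1, K.hP2, K.hQ1, K.hQ2, K.hL1, K.hL2,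
      K.hP2.reverse, Walk.support_reverse, List.mem_reverse] at hb ⊢
    grind
  face1 := K.face2
  face2 := K.face1
  face3 := by simpa [Walk.reverse_append, Walk.append_assoc] using isOddHole_reverse K.face3
  face4 := by simpa [Walk.reverse_append, Walk.append_assoc] using isOddHole_reverse K.face4

/-- The same odd `K₄`-subdivision, with the names of `u1` and `u2` exchanged. -/
def swap12 (K : OddK4 G) : OddK4 G where
  u1 := K.u2
  u2 := K.u1
  u3 := K.u3
  u4 := K.u4
  P1 := K.P1.reverse
  P2 := K.P2
  Q1 := K.L1
  Q2 := K.L2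
  L1 := K.Q1
  L2 := K.Q2
  hP1 := K.hP1.reverse
  hP2 := K.hP2
  hQ1 := K.hL1
  hQ2 := K.hL2
  hL1 := K.hQ1
  hL2 := K.hQ2
  hnodup := by
    obtain ⟨n12, n13, n14, n23, n24, n34⟩ := K.ne
    simp [*, n12.symm]
  hdisj := by
    simp only [List.pairwise_cons, List.mem_cons, List.not_mem_nil, or_false, forall_eq_or_imp,
      forall_eq, List.disjoint_left, mem_interiorL, K.hP2, K.hQ1, K.hQ2, K.hL1, K.hL2,
      K.hP1.reverse, Walk.support_reverse, List.mem_reverse]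
    refine ⟨⟨?_, ?_, ?_, ?_, ?_⟩, ⟨?_, ?_, ?_, ?_⟩, ⟨?_, ?_, ?_⟩, ⟨?_, ?_⟩, ?_, by simp⟩ <;>
    · rintro w ⟨hw, h1, h2⟩ ⟨hw', h3, h4⟩
      obtain ⟨_, _, _, _, _, _, _, _, _, _, _, _, _, _, _⟩ := K.meets w
      simp_all
  hbranch := by
    intro w
    have hb := K.hbranch w
    simp only [List.mem_append, mem_interiorL, K.hP1, K.hP2, K.hQ1, K.hQ2, K.hL1, K.hL2,
      K.hP1.reverse, Walk.support_reverse, List.mem_reverse] at hb ⊢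
    grind
  face1 := by
    have h : IsOddHole G ((K.L1.append K.Q1.reverse).append K.P1.reverse) := by
      simpa [Walk.reverse_append, Walk.append_assoc] using isOddHole_reverse K.face1
    simpa [Walk.reverse_append, Walk.append_assoc] using isOddHole_append_comm h
  face2 := by
    have h : IsOddHole G ((K.Q2.append K.L2.reverse).append K.P1.reverse) := by
      simpa [Walk.reverse_append, Walk.append_assoc] using isOddHole_reverse K.face2
    simpa [Walk.reverse_append, Walk.append_assoc] using isOddHole_append_comm h
  face3 := K.face4
  face4 := K.face3

theorem on_swap34 (K : OddK4 G) {w : V} : K.swap34.On w ↔ K.On w := by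
  unfold On
  simp only [swap34, Walk.support_reverse, List.mem_reverse]
  tauto

theorem on_swap12 (K : OddK4 G) {w : V} : K.swap12.On w ↔ K.On w := by
  unfold On
  simp only [swap12, Walk.support_reverse, List.mem_reverse]
  tauto

theorem hasEdge_swap34 (K : OddK4 G) {e : Sym2 V} : K.swap34.HasEdge e ↔ K.HasEdge e := by
  unfold HasEdge
  simp only [swap34, Walk.edges_reverse, List.mem_reverse]
  tauto

theorem hasEdge_swap12 (K : OddK4 G) {e : Sym2 V} : K.swap12.HasEdge e ↔ K.HasEdge e := by
  unfold HasEdge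
  simp only [swap12, Walk.edges_reverse, List.mem_reverse]
  tauto

theorem longestPair_swap34 (K : OddK4 G) (h : K.longestPair) : K.swap34.longestPair := by
  unfold longestPair at *
  simp only [swap34, Walk.length_reverse]
  tauto

theorem longestPair_swap12 (K : OddK4 G) (h : K.longestPair) : K.swap12.longestPair := by
  unfold longestPair at *
  simp only [swap12, Walk.length_reverse]
  tauto

/-- `P` is a path attached to `K` at its two ends only, and `K` together with `P` is induced. -/
structure Attach (K : OddK4 G) {x y : V} (P : G.Walk x y) : Prop where
  isPath : P.IsPath
  inter : ∀ w ∈ P.support, K.On w → w = x ∨ w = y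
  two_le : 2 ≤ P.length
  hasEdge : ∀ u v, (K.On u ∨ u ∈ P.support) → (K.On v ∨ v ∈ P.support) → G.Adj u v →
    K.HasEdge s(u, v) ∨ s(u, v) ∈ P.edges

theorem Attach.swap34 {K : OddK4 G} {x y : V} {P : G.Walk x y} (h : K.Attach P) :
    K.swap34.Attach P :=
  ⟨h.isPath, by simpa only [on_swap34] using h.inter, h.two_le,
    by simpa only [on_swap34, hasEdge_swap34] using h.hasEdge⟩

theorem Attach.swap12 {K : OddK4 G} {x y : V} {P : G.Walk x y} (h : K.Attach P) :
    K.swap12.Attach P :=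
  ⟨h.isPath, by simpa only [on_swap12] using h.inter, h.two_le,
    by simpa only [on_swap12, hasEdge_swap12] using h.hasEdge⟩

end OddK4

/-- An induced subdivision of `K_{3,3}` in `G`. -/
structure InducedK33 (G : SimpleGraph V) where
  A : Fin 3 → V
  B : Fin 3 → V
  W : ∀ i j, G.Walk (A i) (B j)
  isPath : ∀ i j, (W i j).IsPath
  inter : ∀ i j i' j' w, w ∈ (W i j).support → w ∈ (W i' j').support →
    (i = i' ∧ j = j') ∨ (i = i' ∧ w = A i) ∨ (j = j' ∧ w = B j)
  induced : ∀ u v, (∃ i j, u ∈ (W i j).support) → (∃ i j, v ∈ (W i j).support) → G.Adj u v →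
    ∃ i j, s(u, v) ∈ (W i j).edges

namespace InducedK33

variable {G : SimpleGraph V} {ℓ : ℕ}

theorem A_ne_B (M : InducedK33 G) (i j : Fin 3) : M.A i ≠ M.B j := by
  intro h
  have := M.inter i (j + 1) (i + 1) j (M.A i) (Walk.start_mem_support _)
    (by rw [h]; exact Walk.end_mem_support _)
  simp at this

theorem A_injective (M : InducedK33 G) : Function.Injective M.A := by
  intro i i' h
  have := M.inter i 0 i' 1 (M.A i) (Walk.start_mem_support _)
    (by rw [h]; exact Walk.start_mem_support _)
  simp at this
  exact this

theorem B_injective (M : InducedK33 G) : Function.Injective M.B := by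
  intro i i' h
  have := M.inter 0 i 1 i' (M.B i) (Walk.end_mem_support _)
    (by rw [h]; exact Walk.end_mem_support _)
  simp at this
  exact this

theorem length_pos (M : InducedK33 G) (i j : Fin 3) : 0 < (M.W i j).length := by
  rw [← Walk.not_nil_iff_lt_length]
  exact Walk.not_nil_of_ne (M.A_ne_B i j)

/-- Renaming the two sides of a `K_{3,3}`-subdivision. -/
def relabel (M : InducedK33 G) (σ τ : Equiv.Perm (Fin 3)) : InducedK33 G where
  A i := M.A (σ i)
  B j := M.B (τ j)
  W i j := M.W (σ i) (τ j)
  isPath i j := M.isPath _ _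
  inter i j i' j' w hw hw' := by
    simpa using M.inter _ _ _ _ w hw hw'
  induced u v := by
    rintro ⟨i, j, hu⟩ ⟨i', j', hv⟩ huv
    obtain ⟨k, l, h⟩ := M.induced u v ⟨_, _, hu⟩ ⟨_, _, hv⟩ huv
    obtain ⟨k, rfl⟩ := σ.surjective k
    obtain ⟨l, rfl⟩ := τ.surjective l
    exact ⟨k, l, h⟩

/-- The `4`-cycles of a `K_{3,3}`-subdivision are holes. -/
theorem isHole_four (M : InducedK33 G) {i i' j j' : Fin 3} (hi : i ≠ i') (hj : j ≠ j') :
    IsHole G (((M.W i j).append (M.W i' j).reverse).append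
      ((M.W i' j').append (M.W i j').reverse)) := by
  have h0 := M.inter
  apply isHole_append_of_inter
  · refine isPath_append_of_inter (M.isPath _ _) (M.isPath _ _).reverse fun w hw hw' => ?_
    rw [Walk.support_reverse, List.mem_reverse] at hw'
    grind
  · refine isPath_append_of_inter (M.isPath _ _) (M.isPath _ _).reverse fun w hw hw' => ?_
    rw [Walk.support_reverse, List.mem_reverse] at hw'
    grind
  · intro w
    simp only [mem_support_append_reverse]
    grind
  · have := M.length_pos i j
    have := M.length_pos i' j
    have := M.length_pos i j'
    have := M.length_pos i' j'
    simp only [Walk.length_append, Walk.length_reverse]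
    lia
  · intro u v
    simp only [mem_support_append_reverse, Walk.edges_append, Walk.edges_reverse, List.mem_append,
      List.mem_reverse]
    intro hu hv huv
    obtain ⟨k, l, h⟩ := M.induced u v (by grind) (by grind) huv
    have hku := Walk.fst_mem_support_of_mem_edges _ h
    have hkv := Walk.snd_mem_support_of_mem_edges _ h
    have hne := huv.ne
    by_cases hk : k = i ∨ k = i' <;> by_cases hl : l = j ∨ l = j'
    · grind
    all_goals
      exfalso
      grind

theorem ne_ends_of_mem_edges (M : InducedK33 G) {k l : Fin 3}
    (h2 : 2 ≤ (M.W k l).length) {u v : V} (h : s(u, v) ∈ (M.W k l).edges)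
    (hu : u = M.A k ∨ u = M.B l) :
    v ≠ M.A k ∧ v ≠ M.B l := by
  have hne := ((M.W k l).adj_of_mem_edges h).ne
  constructor
  · rintro rfl
    rcases hu with rfl | rfl
    · exact hne rfl
    · rw [Sym2.eq_swap] at h
      have := (M.isPath k l).length_eq_one_of_mem_edges h
      lia
  · rintro rfl
    rcases hu with rfl | rfl
    · have := (M.isPath k l).length_eq_one_of_mem_edges h
      lia
    · exact hne rfl

theorem A_mem_support_iff (M : InducedK33 G) {i k l : Fin 3} :
    M.A i ∈ (M.W k l).support ↔ i = k := by
  refine ⟨fun h => ?_, fun h => by rw [h]; exact Walk.start_mem_support _⟩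
  have := M.inter k l i (l + 1) _ h (Walk.start_mem_support _)
  simp [M.A_injective.eq_iff, M.A_ne_B] at this
  exact this.2

theorem B_mem_support_iff (M : InducedK33 G) {j k l : Fin 3} :
    M.B j ∈ (M.W k l).support ↔ j = l := by
  refine ⟨fun h => ?_, fun h => by rw [h]; exact Walk.end_mem_support _⟩
  have := M.inter k l (k + 1) j _ h (Walk.end_mem_support _)
  simp [M.B_injective.eq_iff, (M.A_ne_B _ _).symm] at this
  exact this.2

theorem isPath_append_reverse (M : InducedK33 G) {i i' : Fin 3} (hi : i ≠ i') (j : Fin 3) :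
    ((M.W i j).append (M.W i' j).reverse).IsPath := by
  refine isPath_append_of_inter (M.isPath _ _) (M.isPath _ _).reverse fun w hw hw' => ?_
  rw [Walk.support_reverse, List.mem_reverse] at hw'
  simpa [hi] using M.inter _ _ _ _ w hw hw'

theorem isPath_reverse_append (M : InducedK33 G) (i : Fin 3) {j j' : Fin 3} (hj : j ≠ j') :
    ((M.W i j).reverse.append (M.W i j')).IsPath := by
  refine isPath_append_of_inter (M.isPath _ _).reverse (M.isPath _ _) fun w hw hw' => ?_
  rw [Walk.support_reverse, List.mem_reverse] at hw
  simpa [hj] using M.inter _ _ _ _ w hw hw'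

/-- A `6`-cycle of a `K_{3,3}`-subdivision is a hole if none of its long chords is an edge. -/
theorem isHole_six (M : InducedK33 G) (h01 : 2 ≤ (M.W 0 1).length) (h10 : 2 ≤ (M.W 1 0).length)
    (h22 : 2 ≤ (M.W 2 2).length) :
    IsHole G (((M.W 0 0).append ((M.W 2 0).reverse.append (M.W 2 1))).append
      ((M.W 1 1).reverse.append ((M.W 1 2).append (M.W 0 2).reverse))) := by
  have key : ∀ k l u v, (k = 0 ∧ l = 1) ∨ (k = 1 ∧ l = 0) ∨ (k = 2 ∧ l = 2) →
      s(u, v) ∈ (M.W k l).edges → (u = M.A k ∨ u = M.B l) → (v = M.A k ∨ v = M.B l) → False := by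
    intro k l u v hkl he hu hv
    have := M.ne_ends_of_mem_edges (k := k) (l := l)
      (by rcases hkl with ⟨rfl, rfl⟩ | ⟨rfl, rfl⟩ | ⟨rfl, rfl⟩ <;> assumption) he hu
    tauto
  have hcyc : ∀ k l k' l' u, (k = 0 ∧ l = 1) ∨ (k = 1 ∧ l = 0) ∨ (k = 2 ∧ l = 2) →
      u ∈ (M.W k l).support → ¬ (k = k' ∧ l = l') → u ∈ (M.W k' l').support →
      u = M.A k ∨ u = M.B l := by
    intro k l k' l' u _ hu hn hu'
    have := M.inter k l k' l' u hu hu'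
    tauto
  apply isHole_append_of_inter
  · refine isPath_append_of_inter (M.isPath _ _) (isPath_append_of_inter (M.isPath _ _).reverse
      (M.isPath _ _) fun w hw hw' => ?_) fun w hw hw' => ?_
    · rw [Walk.support_reverse, List.mem_reverse] at hw
      have := M.inter _ _ _ _ w hw hw'
      simpa using this
    · rw [Walk.mem_support_append_iff, Walk.support_reverse, List.mem_reverse] at hw'
      rcases hw' with hw' | hw'
      all_goals simpa using M.inter _ _ _ _ w hw hw'
  · refine isPath_append_of_inter (M.isPath _ _).reverse (isPath_append_of_inter (M.isPath _ _)
      (M.isPath _ _).reverse fun w hw hw' => ?_) fun w hw hw' => ?_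
    · rw [Walk.support_reverse, List.mem_reverse] at hw'
      have := M.inter _ _ _ _ w hw hw'
      simpa using this
    · rw [Walk.support_reverse, List.mem_reverse] at hw
      rw [Walk.mem_support_append_iff, Walk.support_reverse, List.mem_reverse] at hw'
      rcases hw' with hw' | hw'
      all_goals simpa using M.inter _ _ _ _ w hw hw'
  · intro w
    simp only [Walk.mem_support_append_iff, Walk.support_reverse, List.mem_reverse]
    rintro (hw | hw | hw) (hw' | hw' | hw')
    all_goals
      have := M.inter _ _ _ _ w hw hw'
      simp_all
  · simp only [Walk.length_append, Walk.length_reverse]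
    have := M.length_pos 0 0
    have := M.length_pos 2 0
    have := M.length_pos 2 1
    have := M.length_pos 1 1
    lia
  · intro u v
    simp only [Walk.mem_support_append_iff, Walk.support_reverse, List.mem_reverse,
      Walk.edges_append, Walk.edges_reverse, List.mem_append]
    intro hu hv huv
    obtain ⟨k, l, h⟩ := M.induced u v (by grind) (by grind) huv
    have hku := Walk.fst_mem_support_of_mem_edges _ h
    have hkv := Walk.snd_mem_support_of_mem_edges _ h
    by_cases hkl : (k = 0 ∧ l = 1) ∨ (k = 1 ∧ l = 0) ∨ (k = 2 ∧ l = 2)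
    · refine (key k l u v hkl h ?_ ?_).elim
      · rcases hu with (hu | hu | hu) | (hu | hu | hu) <;>
          exact hcyc k l _ _ u hkl hku (by lia) hu
      · rcases hv with (hu | hu | hu) | (hu | hu | hu) <;>
          exact hcyc k l _ _ v hkl hkv (by lia) hu
    · fin_cases k <;> fin_cases l <;> simp at hkl h ⊢ <;> simp [h]

/-- Removing one of the nine paths of a `K_{3,3}`-subdivision gives a subdivision of `K₄`. -/
def toOddK4 (M : InducedK33 G)
    (h1 : Odd ((M.W 1 1).length + (M.W 2 1).length + (M.W 2 0).length + (M.W 1 0).length))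
    (h2 : Odd ((M.W 1 1).length + (M.W 0 1).length + (M.W 0 2).length + (M.W 1 2).length))
    (h3 : Odd ((M.W 1 0).length + (M.W 2 0).length + (M.W 2 2).length + (M.W 1 2).length))
    (h4 : Odd ((M.W 0 1).length + (M.W 2 1).length + (M.W 2 2).length + (M.W 0 2).length)) :
    OddK4 G where
  u1 := M.A 1
  u2 := M.B 1
  u3 := M.A 2
  u4 := M.B 2
  P1 := M.W 1 1
  P2 := M.W 2 2
  Q1 := (M.W 2 1).reverse
  Q2 := M.W 1 2
  L1 := (M.W 1 0).append (M.W 2 0).reverse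
  L2 := (M.W 0 1).reverse.append (M.W 0 2)
  hP1 := M.isPath _ _
  hP2 := M.isPath _ _
  hQ1 := (M.isPath _ _).reverse
  hQ2 := M.isPath _ _
  hL1 := M.isPath_append_reverse (by decide) 0
  hL2 := M.isPath_reverse_append 0 (by decide)
  hnodup := by
    have hA := M.A_ne_B
    have hA' := fun k l => (M.A_ne_B k l).symm
    simp [hA, hA', M.A_injective.eq_iff, M.B_injective.eq_iff]
  hdisj := by
    simp only [List.pairwise_cons, List.mem_cons, List.not_mem_nil, or_false, forall_eq_or_imp,
      forall_eq, List.disjoint_left, mem_interiorL, M.isPath, (M.isPath _ _).reverse,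
      M.isPath_append_reverse (show (1 : Fin 3) ≠ 2 by decide) 0,
      M.isPath_reverse_append 0 (show (1 : Fin 3) ≠ 2 by decide),
      Walk.support_reverse, List.mem_reverse, Walk.mem_support_append_iff]
    refine ⟨⟨?_, ?_, ?_, ?_, ?_⟩, ⟨?_, ?_, ?_, ?_⟩, ⟨?_, ?_, ?_⟩, ⟨?_, ?_⟩, ?_, by simp⟩
    all_goals
      rintro w ⟨hw, hw1, hw2⟩ ⟨hw', hw3, hw4⟩
      first
      | have := M.inter _ _ _ _ w hw hw'
        simp_all
      | obtain hw' | hw' := hw' <;>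
        · have := M.inter _ _ _ _ w hw hw'
          simp_all
      | obtain hw | hw := hw <;> obtain hw' | hw' := hw' <;>
        · have := M.inter _ _ _ _ w hw hw'
          simp_all
  hbranch := by
    intro w
    simp only [List.mem_append, mem_interiorL, M.isPath, (M.isPath _ _).reverse,
      M.isPath_append_reverse (show (1 : Fin 3) ≠ 2 by decide) 0,
      M.isPath_reverse_append 0 (show (1 : Fin 3) ≠ 2 by decide),
      Walk.support_reverse, List.mem_reverse, Walk.mem_support_append_iff, List.mem_cons,
      List.not_mem_nil, or_false]
    have hA := M.A_ne_B
    have hA' := fun k l => (M.A_ne_B k l).symm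
    rintro hw (rfl | rfl | rfl | rfl) <;>
      simp [M.A_mem_support_iff, M.B_mem_support_iff, hA, hA', M.A_injective.eq_iff,
        M.B_injective.eq_iff] at hw
  face1 := by
    have h := M.isHole_four (i := 1) (i' := 2) (j := 1) (j' := 0) (by decide) (by decide)
    have h' : IsOddHole G _ := ⟨h, by simpa [add_assoc] using h1⟩
    simpa [Walk.reverse_append, Walk.append_assoc] using h'
  face2 := by
    have h := M.isHole_four (i := 1) (i' := 0) (j := 1) (j' := 2) (by decide) (by decide)
    have h' : IsOddHole G _ := ⟨h, by simpa [add_assoc] using h2⟩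
    simpa [Walk.reverse_append, Walk.append_assoc] using h'
  face3 := by
    have h := M.isHole_four (i := 1) (i' := 2) (j := 0) (j' := 2) (by decide) (by decide)
    have h' : IsOddHole G _ := ⟨h, by simpa [add_assoc] using h3⟩
    simpa [Walk.reverse_append, Walk.append_assoc] using h'
  face4 := by
    have h := M.isHole_four (i := 0) (i' := 2) (j := 1) (j' := 2) (by decide) (by decide)
    have h' : IsOddHole G ((M.W 0 1).append ((M.W 2 1).reverse.append
        ((M.W 2 2).append (M.W 0 2).reverse))) := by
      rw [Walk.append_assoc]
      exact ⟨h, by simpa [add_assoc] using h4⟩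
    simpa [Walk.reverse_append, Walk.append_assoc] using isOddHole_append_comm h'

theorem relabel_length (M : InducedK33 G) (σ τ : Equiv.Perm (Fin 3)) (i j : Fin 3) :
    ((M.relabel σ τ).W i j).length = (M.W (σ i) (τ j)).length :=
  rfl

theorem exists_oddK4 (M : InducedK33 G) (σ τ : Equiv.Perm (Fin 3)) {n : Fin 3 → Fin 3 → ℕ}
    (hn : ∀ i j, (M.W i j).length = n i j)
    (h1 : Odd (n (σ 1) (τ 1) + n (σ 2) (τ 1) + n (σ 2) (τ 0) + n (σ 1) (τ 0)))
    (h2 : Odd (n (σ 1) (τ 1) + n (σ 0) (τ 1) + n (σ 0) (τ 2) + n (σ 1) (τ 2)))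
    (h3 : Odd (n (σ 1) (τ 0) + n (σ 2) (τ 0) + n (σ 2) (τ 2) + n (σ 1) (τ 2)))
    (h4 : Odd (n (σ 0) (τ 1) + n (σ 2) (τ 1) + n (σ 2) (τ 2) + n (σ 0) (τ 2))) :
    ∃ K : OddK4 G, K.P1.length = n (σ 1) (τ 1) ∧ K.P2.length = n (σ 2) (τ 2) ∧
      K.Q1.length = n (σ 2) (τ 1) ∧ K.Q2.length = n (σ 1) (τ 2) ∧
      K.L1.length = n (σ 1) (τ 0) + n (σ 2) (τ 0) ∧
      K.L2.length = n (σ 0) (τ 1) + n (σ 0) (τ 2) := by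
  refine ⟨(M.relabel σ τ).toOddK4 ?_ ?_ ?_ ?_, ?_⟩
  rotate_right
  · simp only [toOddK4, Walk.length_append, Walk.length_reverse, relabel_length, hn, and_self]
  all_goals simpa only [relabel_length, hn]

theorem false_of_minimal_diff (M : InducedK33 G) (hG : InGFamily ℓ G) (hℓ : 5 ≤ ℓ) {p q l : ℕ}
    (hp : p ≤ ℓ) (hqp : q ≤ p) (hlp : l ≤ p) (hsum : p + q + l = 2 * ℓ + 1)
    (h0 : (M.W 0 1).length + (M.W 0 2).length = p) (h0' : (M.W 1 0).length + (M.W 2 0).length = p)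
    (h11 : (M.W 1 1).length = l) (h22 : (M.W 2 2).length = l)
    (h12 : (M.W 1 2).length = q) (h21 : (M.W 2 1).length = q)
    (hodd : Odd ((M.W 0 0).length + (M.W 1 0).length + (M.W 1 1).length + (M.W 0 1).length))
    (hmin : ∀ K : OddK4 G, K.longestPair → p - min q l ≤ K.diff) : False := by
  have four := fun i i' j j' (hi : i ≠ i') (hj : j ≠ j') h =>
    hG.2 _ _ ⟨M.isHole_four (i := i) (i' := i') (j := j) (j' := j') hi hj, h⟩
  have g2 := girth_le_length hG.1 (M.isHole_four (i := 0) (i' := 2) (j := 0) (j' := 1)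
    (by decide) (by decide)).1
  have g3 := girth_le_length hG.1 (M.isHole_four (i := 0) (i' := 1) (j := 0) (j' := 2)
    (by decide) (by decide)).1
  have c1 := four 0 1 0 1 (by decide) (by decide)
  have c4 := four 0 2 0 2 (by decide) (by decide)
  have six := fun h h' h'' ho => hG.2 _ _ ⟨M.isHole_six h h' h'', ho⟩
  have p10 := M.length_pos 1 0
  have p20 := M.length_pos 2 0
  simp only [Walk.length_append, Walk.length_reverse, Nat.odd_iff] at c1 c4 six g2 g3 hodd
  specialize c1 (by omega)
  specialize c4 (by omega)
  have hn : (M.W 0 0).length = q := by lia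
  have hst : (M.W 0 1).length + (M.W 1 0).length = p := by lia
  have hone : (M.W 0 1).length = 1 ∨ (M.W 1 0).length = 1 ∨ l = 1 := by
    by_contra! h
    omega
  have hq : q = ℓ := by lia
  have hl : l = 1 := by lia
  have e02 : (M.W 0 2).length = (M.W 1 0).length := by omega
  have e20 : (M.W 2 0).length = (M.W 0 1).length := by omega
  clear four six g2 g3 hone hodd c1 c4 h0 h0'
  subst hq hl
  obtain ⟨n, hn'⟩ : ∃ n : Fin 3 → Fin 3 → ℕ, ∀ i j, (M.W i j).length = n i j := ⟨_, fun _ _ => rfl⟩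
  have ex := fun σ τ => M.exists_oddK4 σ τ hn'
  simp only [hn'] at *
  by_cases ht : 2 ≤ n 1 0
  · obtain ⟨K, k⟩ := ex ⟨![2, 0, 1], ![1, 2, 0], by decide, by decide⟩
      ⟨![1, 0, 2], ![1, 0, 2], by decide, by decide⟩
      (by simp [Nat.odd_iff]; omega) (by simp [Nat.odd_iff]; omega) (by simp [Nat.odd_iff]; omega)
      (by simp [Nat.odd_iff]; omega)
    simp at k
    have := hmin K (by unfold OddK4.longestPair; omega)
    unfold OddK4.diff at this
    omega
  · obtain ⟨K, k⟩ := ex ⟨![1, 0, 2], ![1, 0, 2], by decide, by decide⟩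
      ⟨![2, 0, 1], ![1, 2, 0], by decide, by decide⟩
      (by simp [Nat.odd_iff]; omega) (by simp [Nat.odd_iff]; omega) (by simp [Nat.odd_iff]; omega)
      (by simp [Nat.odd_iff]; omega)
    simp at k
    have := hmin K (by unfold OddK4.longestPair; omega)
    unfold OddK4.diff at this
    omega

end InducedK33

namespace OddK4

variable {G : SimpleGraph V} {ℓ : ℕ}

set_option maxHeartbeats 1000000 in
theorem Attach.exists_inducedK33 {K : OddK4 G} {x y : V} {P : G.Walk x y} (h : K.Attach P)
    {p1 : G.Walk K.u1 x} {p2 : G.Walk x K.u2} {r1 : G.Walk K.u3 y} {r2 : G.Walk y K.u4}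
    (hp : K.P1 = p1.append p2) (hr : K.P2 = r1.append r2) (hx1 : x ≠ K.u1) (hx2 : x ≠ K.u2)
    (hy3 : y ≠ K.u3) (hy4 : y ≠ K.u4) :
    ∃ M : InducedK33 G, (M.W 0 0).length = P.length ∧ (M.W 0 1).length = p1.length ∧
      (M.W 0 2).length = p2.length ∧ (M.W 1 0).length = r1.length ∧
      (M.W 2 0).length = r2.length ∧ (M.W 1 1).length = K.L1.length ∧
      (M.W 2 2).length = K.L2.length ∧ (M.W 1 2).length = K.Q1.length ∧
      (M.W 2 1).length = K.Q2.length := by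
  have hpp : (p1.append p2).IsPath := hp ▸ K.hP1
  have hrp : (r1.append r2).IsPath := hr ▸ K.hP2
  have mP1 : ∀ w, w ∈ K.P1.support ↔ w ∈ p1.support ∨ w ∈ p2.support := fun w => by
    rw [hp, Walk.mem_support_append_iff]
  have mP2 : ∀ w, w ∈ K.P2.support ↔ w ∈ r1.support ∨ w ∈ r2.support := fun w => by
    rw [hr, Walk.mem_support_append_iff]
  have hx : x ∉ K.P2.support ∧ x ∉ K.Q1.support ∧ x ∉ K.Q2.support ∧ x ∉ K.L1.support ∧
      x ∉ K.L2.support := by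
    have hx : x ∈ K.P1.support := (mP1 x).2 (Or.inl p1.end_mem_support)
    have := K.meets x
    exact ⟨this.P1P2 hx, fun h => hx2 (this.P1Q1 hx h), fun h => hx1 (this.P1Q2 hx h),
      fun h => hx1 (this.P1L1 hx h), fun h => hx2 (this.P1L2 hx h)⟩
  have hy : y ∉ K.P1.support ∧ y ∉ K.Q1.support ∧ y ∉ K.Q2.support ∧ y ∉ K.L1.support ∧
      y ∉ K.L2.support := by
    have hy : y ∈ K.P2.support := (mP2 y).2 (Or.inl r1.end_mem_support)
    have := K.meets y
    exact ⟨fun h => this.P1P2 h hy, fun h => hy3 (this.P2Q1 hy h), fun h => hy4 (this.P2Q2 hy h),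
      fun h => hy3 (this.P2L1 hy h), fun h => hy4 (this.P2L2 hy h)⟩
  rw [mP1] at hy
  rw [mP2] at hx
  have hu1 : K.u1 ∉ p2.support := fun h =>
    hx1 (inter_of_isPath_append hpp p1.start_mem_support h).symm
  have hu2 : K.u2 ∉ p1.support := fun h =>
    hx2 (inter_of_isPath_append hpp h p2.end_mem_support).symm
  have hu3 : K.u3 ∉ r2.support := fun h =>
    hy3 (inter_of_isPath_append hrp r1.start_mem_support h).symm
  have hu4 : K.u4 ∉ r1.support := fun h =>
    hy4 (inter_of_isPath_append hrp h r2.end_mem_support).symm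
  let A : Fin 3 → V := ![x, K.u3, K.u4]
  let B : Fin 3 → V := ![y, K.u1, K.u2]
  let W : ∀ i j, G.Walk (A i) (B j) := fun i j => match i, j with
    | 0, 0 => P
    | 0, 1 => p1.reverse
    | 0, 2 => p2
    | 1, 0 => r1
    | 1, 1 => K.L1.reverse
    | 1, 2 => K.Q1.reverse
    | 2, 0 => r2.reverse
    | 2, 1 => K.Q2.reverse
    | 2, 2 => K.L2.reverse
  let S : Fin 3 → Fin 3 → V → Prop := fun i j w => ![![w ∈ P.support, w ∈ p1.support,
    w ∈ p2.support], ![w ∈ r1.support, w ∈ K.L1.support, w ∈ K.Q1.support],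
    ![w ∈ r2.support, w ∈ K.Q2.support, w ∈ K.L2.support]] i j
  have hS : ∀ i j w, w ∈ (W i j).support ↔ S i j w := by
    intro i j w
    fin_cases i <;> fin_cases j <;> simp [W, S, A, B]
  refine ⟨⟨A, B, W, ?_, ?_, ?_⟩, ?_⟩
  · intro i j
    fin_cases i <;> fin_cases j
    · exact h.isPath
    · exact hpp.of_append_left.reverse
    · exact hpp.of_append_right
    · exact hrp.of_append_left
    · exact K.hL1.reverse
    · exact K.hQ1.reverse
    · exact hrp.of_append_right.reverse
    · exact K.hQ2.reverse
    · exact K.hL2.reverse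
  · intro i j i' j' w
    rw [hS, hS]
    have hw := h.inter w
    obtain ⟨m1, m2, m3, m4, m5, m6, m7, m8, m9, m10, m11, m12, m13, m14, m15⟩ := K.meets w
    simp only [mP1, mP2] at m1 m4 m5 m6 m7 m8 m9 m10 m11
    have i1 := fun h1 h2 => inter_of_isPath_append hpp (w := w) h1 h2
    have i2 := fun h1 h2 => inter_of_isPath_append hrp (w := w) h1 h2
    have d3 : w = K.u3 → w ∉ r2.support := by rintro rfl; exact hu3
    have d4 : w = K.u4 → w ∉ r1.support := by rintro rfl; exact hu4
    have dx : w = x → ¬ (w ∈ r1.support ∨ w ∈ r2.support) ∧ w ∉ K.Q1.support ∧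
        w ∉ K.Q2.support ∧ w ∉ K.L1.support ∧ w ∉ K.L2.support := by
      rintro rfl
      exact hx
    have dy : w = y → ¬ (w ∈ p1.support ∨ w ∈ p2.support) ∧ w ∉ K.Q1.support ∧
        w ∉ K.Q2.support ∧ w ∉ K.L1.support ∧ w ∉ K.L2.support := by
      rintro rfl
      exact hy
    simp only [On, mP1, mP2] at hw
    fin_cases i <;> fin_cases j <;> fin_cases i' <;> fin_cases j' <;>
      simp [S, A, B] <;> grind
  · intro u v
    simp only [hS]
    have hall : ∀ w, (∃ i j, S i j w) → K.On w ∨ w ∈ P.support := by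
      rintro w ⟨i, j, hw⟩
      simp only [On, mP1, mP2]
      fin_cases i <;> fin_cases j <;> simp [S] at hw <;> simp [hw]
    intro hu hv huv
    have := h.hasEdge u v (hall u hu) (hall v hv) huv
    rw [HasEdge, hp, hr, Walk.edges_append, Walk.edges_append, List.mem_append,
      List.mem_append] at this
    have er : ∀ {a b : V} {p : G.Walk a b} {e : Sym2 V}, e ∈ p.edges → e ∈ p.reverse.edges :=
      fun h => by simpa using h
    obtain ((h | h) | (h | h) | h | h | h | h) | h := this
    · exact ⟨0, 1, er h⟩
    · exact ⟨0, 2, h⟩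
    · exact ⟨1, 0, h⟩
    · exact ⟨2, 0, er h⟩
    · exact ⟨1, 2, er h⟩
    · exact ⟨2, 1, er h⟩
    · exact ⟨1, 1, er h⟩
    · exact ⟨2, 2, er h⟩
    · exact ⟨0, 0, h⟩
  · simp [W, A, B]

theorem Attach.false_of_odd {K : OddK4 G} {x y : V} {P : G.Walk x y} (h : K.Attach P)
    (hG : InGFamily ℓ G) (hℓ : 5 ≤ ℓ) (hlong : K.longestPair)
    {p1 : G.Walk K.u1 x} {p2 : G.Walk x K.u2} {r1 : G.Walk K.u3 y} {r2 : G.Walk y K.u4}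
    (hp : K.P1 = p1.append p2) (hr : K.P2 = r1.append r2) (hx1 : x ≠ K.u1) (hx2 : x ≠ K.u2)
    (hy3 : y ≠ K.u3) (hy4 : y ≠ K.u4)
    (hmin : ∀ K' : OddK4 G, K'.longestPair →
      K.P1.length - min K.Q1.length K.L1.length ≤ K'.diff)
    (hodd : Odd (P.length + r1.length + K.L1.length + p1.length)) : False := by
  obtain ⟨M, m00, m01, m02, m10, m20, m11, m22, m12, m21⟩ :=
    h.exists_inducedK33 hp hr hx1 hx2 hy3 hy4
  obtain ⟨h1, h2, h3, h4⟩ := K.length_faces hG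
  have hp' := congrArg Walk.length hp
  have hr' := congrArg Walk.length hr
  rw [Walk.length_append] at hp' hr'
  exact M.false_of_minimal_diff hG hℓ (K.length_P1_le hG) hlong.1 hlong.2.2.1 h4 (by lia) (by lia)
    m11 (by lia) m12 (by lia) (by rwa [m00, m10, m11, m01]) hmin

theorem Attach.false_of_interior {K : OddK4 G} {x y : V} {P : G.Walk x y} (h : K.Attach P)
    (hG : InGFamily ℓ G) (hℓ : 5 ≤ ℓ) (hlong : K.longestPair)
    (hx : x ∈ K.P1.support) (hx1 : x ≠ K.u1) (hx2 : x ≠ K.u2)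
    (hy : y ∈ K.P2.support) (hy3 : y ≠ K.u3) (hy4 : y ≠ K.u4)
    (hmin : ∀ K' : OddK4 G, K'.longestPair →
      K.P1.length - min K.Q1.length K.L1.length ≤ K'.diff) : False := by
  obtain ⟨p1, p2, hp⟩ := Walk.mem_support_iff_exists_append.1 hx
  obtain ⟨r1, r2, hr⟩ := Walk.mem_support_iff_exists_append.1 hy
  obtain ⟨h1, h2, h3, h4⟩ := K.length_faces hG
  have hr' := congrArg Walk.length hr
  rw [Walk.length_append] at hr'
  by_cases hodd : Odd (P.length + r1.length + K.L1.length + p1.length)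
  · exact h.false_of_odd hG hℓ hlong hp hr hx1 hx2 hy3 hy4 hmin hodd
  · refine h.swap34.false_of_odd hG hℓ (K.longestPair_swap34 hlong) (p1 := p1) (p2 := p2)
      (r1 := r2.reverse) (r2 := r1.reverse) hp ?_ hx1 hx2 hy4 hy3 ?_ ?_
    · simp only [OddK4.swap34, hr, Walk.reverse_append]
    · simp only [OddK4.swap34, ← h2, ← h3]
      rwa [min_comm]
    · simp only [OddK4.swap34, Walk.length_reverse]
      rw [Nat.odd_iff] at *
      omega

theorem Attach.isHole_of_start {K : OddK4 G} {y : V} {P : G.Walk K.u1 y} (h : K.Attach P)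
    {r1 : G.Walk K.u3 y} {r2 : G.Walk y K.u4} (hr : K.P2 = r1.append r2)
    (hy3 : y ≠ K.u3) (hy4 : y ≠ K.u4) :
    IsHole G ((P.append r1.reverse).append K.L1.reverse) ∧
      (2 ≤ K.Q2.length →
        IsHole G ((K.P1.append K.L2).append (r2.reverse.append P.reverse))) := by
  have hrp : (r1.append r2).IsPath := hr ▸ K.hP2
  have mP2 : ∀ w, w ∈ K.P2.support ↔ w ∈ r1.support ∨ w ∈ r2.support := fun w => by
    rw [hr, Walk.mem_support_append_iff]
  have hy : y ∉ K.P1.support ∧ y ∉ K.Q1.support ∧ y ∉ K.Q2.support ∧ y ∉ K.L1.support ∧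
      y ∉ K.L2.support := by
    have hy : y ∈ K.P2.support := (mP2 y).2 (Or.inl r1.end_mem_support)
    have := K.meets y
    exact ⟨fun h => this.P1P2 h hy, fun h => hy3 (this.P2Q1 hy h), fun h => hy4 (this.P2Q2 hy h),
      fun h => hy3 (this.P2L1 hy h), fun h => hy4 (this.P2L2 hy h)⟩
  have hu1 : K.u1 ∉ K.P2.support ∧ K.u1 ∉ K.Q1.support ∧ K.u1 ∉ K.L2.support := by
    have := K.meets K.u1
    exact ⟨this.P1P2 K.P1.start_mem_support, fun h => this.Q1Q2 h K.Q2.start_mem_support,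
      this.L1L2 K.L1.start_mem_support⟩
  have hu3 : K.u3 ∉ r2.support := fun h =>
    hy3 (inter_of_isPath_append hrp r1.start_mem_support h).symm
  have hu4 : K.u4 ∉ r1.support := fun h =>
    hy4 (inter_of_isPath_append hrp h r2.end_mem_support).symm
  have hPP1 : ∀ w ∈ P.support, w ∈ K.P1.support → w = K.u1 := fun w hw hw' =>
    (h.inter w hw (Or.inl hw')).resolve_right fun e => hy.1 (e ▸ hw')
  have hPP2 : ∀ w ∈ P.support, w ∈ K.P2.support → w = y := fun w hw hw' =>
    (h.inter w hw (Or.inr (Or.inl hw'))).resolve_left fun e => hu1.1 (e ▸ hw')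
  have hPQ1 : ∀ w ∈ P.support, w ∉ K.Q1.support := fun w hw hw' =>
    (h.inter w hw (by simp [On, hw'])).elim (fun e => hu1.2.1 (e ▸ hw')) fun e => hy.2.1 (e ▸ hw')
  have hPQ2 : ∀ w ∈ P.support, w ∈ K.Q2.support → w = K.u1 := fun w hw hw' =>
    (h.inter w hw (by simp [On, hw'])).resolve_right fun e => hy.2.2.1 (e ▸ hw')
  have hPL1 : ∀ w ∈ P.support, w ∈ K.L1.support → w = K.u1 := fun w hw hw' =>
    (h.inter w hw (by simp [On, hw'])).resolve_right fun e => hy.2.2.2.1 (e ▸ hw')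
  have hPL2 : ∀ w ∈ P.support, w ∉ K.L2.support := fun w hw hw' =>
    (h.inter w hw (by simp [On, hw'])).elim (fun e => hu1.2.2 (e ▸ hw'))
      fun e => hy.2.2.2.2 (e ▸ hw')
  have hrr : ∀ w ∈ r1.support, w ∈ r2.support → w = y := fun w h1 h2 =>
    inter_of_isPath_append hrp h1 h2
  have hlen := K.length_pos
  have hr1 : 0 < r1.length := Walk.not_nil_iff_lt_length.1 (Walk.not_nil_of_ne hy3.symm)
  have hn := h.two_le
  have key : ∀ u v, G.Adj u v → (K.On u ∨ u ∈ P.support) → (K.On v ∨ v ∈ P.support) →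
      (s(u, v) ∈ K.P1.edges ∨ (s(u, v) ∈ r1.edges ∨ s(u, v) ∈ r2.edges) ∨ s(u, v) ∈ K.Q1.edges ∨
        s(u, v) ∈ K.Q2.edges ∨ s(u, v) ∈ K.L1.edges ∨ s(u, v) ∈ K.L2.edges) ∨
        s(u, v) ∈ P.edges := fun u v huv hu hv => by
    have := h.hasEdge u v hu hv huv
    rwa [HasEdge, hr, Walk.edges_append, List.mem_append] at this
  have absurd_of : ∀ {u v c a b : V} (p : G.Walk a b) (S : V → Prop), G.Adj u v → S u → S v →
      s(u, v) ∈ p.edges → (∀ w, S w → w ∈ p.support → w = c) → False :=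
    fun p S huv hu hv he hS => huv.ne ((hS _ hu (p.fst_mem_support_of_mem_edges he)).trans
      (hS _ hv (p.snd_mem_support_of_mem_edges he)).symm)
  have hPr1 : (P.append r1.reverse).IsPath := by
    refine isPath_append_of_inter h.isPath hrp.of_append_left.reverse fun w hw hw' => ?_
    rw [Walk.support_reverse, List.mem_reverse] at hw'
    exact hPP2 w hw ((mP2 w).2 (Or.inl hw'))
  have hPr2 : (r2.reverse.append P.reverse).IsPath := by
    refine isPath_append_of_inter hrp.of_append_right.reverse h.isPath.reverse fun w hw hw' => ?_
    rw [Walk.support_reverse, List.mem_reverse] at hw hw'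
    exact hPP2 w hw' ((mP2 w).2 (Or.inr hw))
  constructor
  · apply isHole_append_of_inter hPr1 K.hL1.reverse
    · intro w
      have := K.meets w
      rw [mem_support_append_reverse, Walk.support_reverse, List.mem_reverse]
      rintro (hw | hw) hw'
      · exact Or.inl (hPL1 w hw hw')
      · exact Or.inr (this.P2L1 ((mP2 w).2 (Or.inl hw)) hw')
    · simp only [Walk.length_append, Walk.length_reverse]
      lia
    · intro u v
      simp only [mem_support_append_reverse, Walk.support_reverse, List.mem_reverse,
        Walk.edges_append, List.mem_append, Walk.edges_reverse]
      set S : V → Prop := fun w => (w ∈ P.support ∨ w ∈ r1.support) ∨ w ∈ K.L1.support with hS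
      change S u → S v → _
      intro hu hv huv
      have hon : ∀ w, S w → K.On w ∨ w ∈ P.support := by
        rintro w ((hw | hw) | hw) <;> simp [On, mP2, hw]
      obtain (h | (h | h) | h | h | h | h) | h := key u v huv (hon u hu) (hon v hv)
      · refine (absurd_of _ S huv hu hv h (c := K.u1) fun w hw hw' => ?_).elim
        have := K.meets w
        grind [Meets]
      · simp [h]
      · refine (absurd_of _ S huv hu hv h (c := y) fun w hw hw' => ?_).elim
        have := K.meets w
        grind [Meets]
      · refine (absurd_of _ S huv hu hv h (c := K.u3) fun w hw hw' => ?_).elim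
        have := K.meets w
        grind [Meets]
      · refine (absurd_of _ S huv hu hv h (c := K.u1) fun w hw hw' => ?_).elim
        have := K.meets w
        grind [Meets]
      · simp [h]
      · refine (absurd_of _ S huv hu hv h (c := K.u1) fun w hw hw' => ?_).elim
        have := K.meets w
        grind [Meets]
      · simp [h]
  · intro hQ2
    apply isHole_append_of_inter (isPath_append_of_inter K.hP1 K.hL2 fun w h1 h2 =>
      (K.meets w).P1L2 h1 h2) hPr2
    · intro w
      have := K.meets w
      rw [mem_support_append_reverse, Walk.support_reverse, List.mem_reverse,
        Walk.mem_support_append_iff]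
      rintro (hw | hw) (hw' | hw')
      · exact (this.P1P2 hw ((mP2 w).2 (Or.inr hw'))).elim
      · exact Or.inl (hPP1 w hw' hw)
      · exact Or.inr (this.P2L2 ((mP2 w).2 (Or.inr hw')) hw)
      · exact (hPL2 w hw' hw).elim
    · simp only [Walk.length_append, Walk.length_reverse]
      lia
    · intro u v
      simp only [Walk.support_reverse, List.mem_reverse,
        Walk.mem_support_append_iff, Walk.edges_append, List.mem_append, Walk.edges_reverse]
      set S : V → Prop := fun w => (w ∈ K.P1.support ∨ w ∈ K.L2.support) ∨
        w ∈ r2.support ∨ w ∈ P.support with hS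
      change S u → S v → _
      intro hu hv huv
      have hon : ∀ w, S w → K.On w ∨ w ∈ P.support := by
        rintro w ((hw | hw) | hw | hw) <;> simp [On, mP2, hw]
      obtain (h | (h | h) | h | h | h | h) | h := key u v huv (hon u hu) (hon v hv)
      · simp [h]
      · refine (absurd_of _ S huv hu hv h (c := y) fun w hw hw' => ?_).elim
        have := K.meets w
        grind [Meets]
      · simp [h]
      · refine (absurd_of _ S huv hu hv h (c := K.u2) fun w hw hw' => ?_).elim
        have := K.meets w
        grind [Meets]
      · have hc : ∀ w, S w → w ∈ K.Q2.support → w = K.u1 ∨ w = K.u4 := by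
          intro w hw hw'
          have := K.meets w
          grind [Meets]
        have h1 := hc u hu (K.Q2.fst_mem_support_of_mem_edges h)
        have h2 := hc v hv (K.Q2.snd_mem_support_of_mem_edges h)
        have := huv.ne
        exfalso
        have := fun h => K.hQ2.length_eq_one_of_mem_edges h
        grind
      · refine (absurd_of _ S huv hu hv h (c := K.u1) fun w hw hw' => ?_).elim
        have := K.meets w
        grind [Meets]
      · simp [h]
      · simp [h]

theorem Attach.false_of_start_of_odd {K : OddK4 G} {y : V} {P : G.Walk K.u1 y} (h : K.Attach P)
    (hG : InGFamily ℓ G) (hlong : K.longestPair)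
    {r1 : G.Walk K.u3 y} {r2 : G.Walk y K.u4} (hr : K.P2 = r1.append r2)
    (hy3 : y ≠ K.u3) (hy4 : y ≠ K.u4)
    (hodd : Odd (P.length + r1.length + K.L1.length)) : False := by
  obtain ⟨h1, h2, h3, h4⟩ := K.length_faces hG
  have hp := K.length_P1_le hG
  have hr1 : 0 < r1.length := Walk.not_nil_iff_lt_length.1 (Walk.not_nil_of_ne hy3.symm)
  have hr2 : 0 < r2.length := Walk.not_nil_iff_lt_length.1 (Walk.not_nil_of_ne hy4)
  have hr' := congrArg Walk.length hr
  have hq := K.length_pos.2.2.2.1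
  obtain ⟨c1, c4⟩ := h.isHole_of_start hr hy3 hy4
  have hr34 : K.P2.reverse = r2.reverse.append r1.reverse := by rw [hr, Walk.reverse_append]
  have c2 : 2 * ℓ + 1 ≤ ((P.append r2.reverse.reverse).append K.Q2.reverse).length :=
    girth_le_length hG.1 (h.swap34.isHole_of_start (r1 := r2.reverse) (r2 := r1.reverse)
    hr34 hy4 hy3).1.1
  have c1 := hG.2 _ _ ⟨c1, by simpa using hodd⟩
  have c4 := fun h ho => hG.2 _ _ ⟨c4 h, ho⟩
  simp only [Walk.length_append, Walk.length_reverse, Nat.odd_iff] at c1 c2 c4 hr' hodd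
  unfold longestPair at hlong
  have hq1 : K.Q2.length = 1 := by
    by_contra hne
    have := c4 (by omega) (by omega)
    omega
  omega

theorem Attach.false_of_start {K : OddK4 G} {y : V} {P : G.Walk K.u1 y} (h : K.Attach P)
    (hG : InGFamily ℓ G) (hlong : K.longestPair)
    (hy : y ∈ K.P2.support) (hy3 : y ≠ K.u3) (hy4 : y ≠ K.u4) : False := by
  obtain ⟨r1, r2, hr⟩ := Walk.mem_support_iff_exists_append.1 hy
  obtain ⟨h1, h2, h3, h4⟩ := K.length_faces hG
  have hr' := congrArg Walk.length hr
  rw [Walk.length_append] at hr'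
  by_cases hodd : Odd (P.length + r1.length + K.L1.length)
  · exact h.false_of_start_of_odd hG hlong hr hy3 hy4 hodd
  · refine h.swap34.false_of_start_of_odd hG (K.longestPair_swap34 hlong) (r1 := r2.reverse)
      (r2 := r1.reverse) ?_ hy4 hy3 ?_
    · change K.P2.reverse = _
      rw [hr, Walk.reverse_append]
      rfl
    · change Odd (P.length + r2.reverse.length + K.Q2.length)
      rw [Walk.length_reverse]
      rw [Nat.odd_iff] at *
      omega

theorem Attach.notMem_P1 {K : OddK4 G} {x y : V} {P : G.Walk x y} (h : K.Attach P)
    (hG : InGFamily ℓ G) (hℓ : 5 ≤ ℓ) (hlong : K.longestPair)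
    (hy : y ∈ K.P2.support) (hy3 : y ≠ K.u3) (hy4 : y ≠ K.u4)
    (hmin : ∀ K' : OddK4 G, K'.longestPair → K.diff ≤ K'.diff) : x ∉ K.P1.support := by
  intro hx
  by_cases hx1 : x = K.u1
  · subst hx1
    exact h.false_of_start hG hlong hy hy3 hy4
  by_cases hx2 : x = K.u2
  · subst hx2
    exact h.swap12.false_of_start hG (K.longestPair_swap12 hlong) hy hy3 hy4
  exact h.false_of_interior hG hℓ hlong hx hx1 hx2 hy hy3 hy4 hmin

theorem attach_cons_concat (K : OddK4 G) (hG : InGFamily ℓ G) (hℓ : 2 ≤ ℓ) (hlong : K.longestPair)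
    {v1 v2 x y : V} (Q : G.Walk v1 v2) (hQ : IsInducedPath G Q)
    (hdisj : ∀ w ∈ Q.support, ¬ K.On w) (hx : K.On x) (hy : K.On y) (hxy : x ≠ y)
    (h1 : G.Adj x v1) (h2 : G.Adj v2 y)
    (honly : ∀ w ∈ Q.support, ∀ z, K.On z → G.Adj w z → (w = v1 ∧ z = x) ∨ (w = v2 ∧ z = y)) :
    K.Attach (Walk.cons h1 (Q.concat h2)) := by
  have hxQ : x ∉ Q.support := fun h => hdisj x h hx
  have hyQ : y ∉ Q.support := fun h => hdisj y h hy
  refine ⟨?_, ?_, by simp, ?_⟩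
  · rw [Walk.cons_isPath_iff, Walk.support_concat]
    exact ⟨hQ.1.concat hyQ h2, by simp [hxQ, hxy]⟩
  · intro w hw hw'
    simp only [Walk.support_cons, Walk.support_concat, List.mem_cons,
      List.mem_append, List.not_mem_nil, or_false] at hw
    have := hdisj w
    tauto
  · intro u v hu hv huv
    have hmem : ∀ w, (K.On w ∨ w ∈ (Walk.cons h1 (Q.concat h2)).support) →
        K.On w ∨ w ∈ Q.support := by
      intro w hw
      simp only [Walk.support_cons, Walk.support_concat, List.mem_cons,
        List.mem_append, List.not_mem_nil, or_false] at hw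
      rcases hw with hw | rfl | hw | rfl
      exacts [Or.inl hw, Or.inl hx, Or.inr hw, Or.inl hy]
    simp only [Walk.edges_cons, Walk.edges_concat, List.mem_cons, List.concat_eq_append,
      List.mem_append, List.not_mem_nil, or_false]
    rcases hmem u hu with hu | hu <;> rcases hmem v hv with hv | hv
    · exact Or.inl (K.hasEdge_of_adj hG hℓ hlong hu hv huv)
    · obtain ⟨rfl, rfl⟩ | ⟨rfl, rfl⟩ := honly v hv u hu huv.symm
      · simp
      · simp [Sym2.eq_swap]
    · obtain ⟨rfl, rfl⟩ | ⟨rfl, rfl⟩ := honly u hu v hv huv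
      · simp [Sym2.eq_swap]
      · simp
    · simp [hQ.2 u hu v hv huv]

end OddK4

/-- Claim 3.2: in the setup of the proof of Theorem 1.2 (with
`H` chosen with smallest difference), the attachment vertex `x` is not on `P1`. -/
theorem claim_not_on_P1 {V : Type*}
    (ℓ : ℕ) (hℓ : 5 ≤ ℓ) (G : SimpleGraph V)
    (hG : InGFamily ℓ G) (hcrit : VertexCritical 4 G)
    (K : OddK4 G) (hlong : K.longestPair)
    (hmin : ∀ K' : OddK4 G, K'.longestPair → K.diff ≤ K'.diff)
    (e f : Sym2 V)
    (he : e = s(K.u3, K.P2.getVert 1))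
    (hf : f = s(K.u4, K.P2.getVert (K.P2.length - 1)))
    (v1 v2 : V) (P : (G.deleteEdges {e, f}).Walk v1 v2)
    (hPind : IsInducedPath (G.deleteEdges {e, f}) P)
    (hPdisj : ∀ w ∈ P.support, w ∉ K.verts)
    (hv2nbr : ∃ z ∈ interiorL K.P2, (G.deleteEdges {e, f}).Adj v2 z)
    (hv2only : ∀ w ∈ P.support,
      (∃ z ∈ interiorL K.P2, (G.deleteEdges {e, f}).Adj w z) → w = v2)
    (hv1nbr : ∃ z : V, z ∈ K.verts ∧ z ∉ interiorL K.P2 ∧ (G.deleteEdges {e, f}).Adj v1 z)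
    (hv1only : ∀ w ∈ P.support,
      (∃ z : V, z ∈ K.verts ∧ z ∉ interiorL K.P2 ∧ (G.deleteEdges {e, f}).Adj w z) → w = v1)
    (x y : V)
    (hy : y ∈ interiorL K.P2) (hv2y : G.Adj v2 y)
    (hyuniq : ∀ z ∈ interiorL K.P2, G.Adj v2 z → z = y)
    (hxH : x ∈ K.verts) (hxP2 : x ∉ interiorL K.P2) (hv1x : G.Adj v1 x)
    (hxuniq : ∀ z : V, z ∈ K.verts → z ∉ interiorL K.P2 → G.Adj v1 z → z = x)
    : x ∉ K.P1.support := by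
  have hPon : ∀ w ∈ P.support, ¬ K.On w := fun w hw h => hPdisj w hw (K.mem_verts_iff_on.2 h)
  have hadj : ∀ w ∈ P.support, ∀ z, G.Adj w z → (G.deleteEdges {e, f}).Adj w z := by
    intro w hw z hwz
    refine (deleteEdges_adj).2 ⟨hwz, fun hmem => ?_⟩
    have hP2 : ∀ z ∈ K.P2.support, w ≠ z := fun z hz h =>
      hPon w hw (Or.inr (Or.inl (h ▸ hz)))
    have h3 := hP2 _ K.P2.start_mem_support
    have h4 := hP2 _ K.P2.end_mem_support
    have h5 := hP2 _ (K.P2.getVert_mem_support 1)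
    have h6 := hP2 _ (K.P2.getVert_mem_support (K.P2.length - 1))
    rw [he, hf] at hmem
    simp only [Set.mem_insert_iff, Set.mem_singleton_iff, Sym2.eq_iff] at hmem
    tauto
  have hle : G.deleteEdges {e, f} ≤ G := deleteEdges_le _
  have hind : IsInducedPath G (P.mapLe hle) := by
    refine ⟨hPind.1.mapLe hle, fun u hu v hv huv => ?_⟩
    rw [Walk.support_mapLe_eq_support] at hu hv
    rw [Walk.edges_mapLe_eq_edges]
    exact hPind.2 u hu v hv (hadj u hu v huv)
  have hy' := (mem_interiorL K.hP2).1 hy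
  have hatt := K.attach_cons_concat hG (by lia) hlong (P.mapLe hle) hind
    (by simpa only [Walk.support_mapLe_eq_support] using hPon) (K.mem_verts_iff_on.1 hxH)
    (Or.inr (Or.inl hy'.1)) (fun h => hxP2 (h ▸ hy)) hv1x.symm hv2y (by
      intro w hw z hz hwz
      rw [Walk.support_mapLe_eq_support] at hw
      have hz' := K.mem_verts_iff_on.2 hz
      by_cases hzP : z ∈ interiorL K.P2
      · obtain rfl := hv2only w hw ⟨z, hzP, hadj w hw z hwz⟩
        exact Or.inr ⟨rfl, hyuniq z hzP hwz⟩
      · obtain rfl := hv1only w hw ⟨z, hz', hzP, hadj w hw z hwz⟩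
        exact Or.inl ⟨rfl, hxuniq z hz' hzP hwz⟩)
  exact hatt.notMem_P1 hG hℓ hlong hy'.1 hy'.2.1 hy'.2.2 hmin
end
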